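/- arXiv:1106.1352 — 8 statements merged into one kernel-verified Lean document; each statement's English description precedes it below -/
import Mathlib

section
/- Let E be a real inner product space and let φ : [0,∞) → [0,∞) satisfy φ(0) = 0, φ(t) > 0 for t > 0, and φ strictly increasing on (0,∞). Define A : E → E by A(X) = (φ(‖X‖)/‖X‖)·X for X ≠ 0 and A(0) = 0. Then A is strictly monotone: for all X, Y ∈ E with X ≠ Y one has ⟨A(X) − A(Y), X − Y⟩ > 0. -/
open scoped RealInnerProductSpace

/-- The cross term of a radial field splits into a scalar monotonicity part and a
Cauchy-Schwarz defect. -/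
lemma inner_smul_sub_smul_sub {E : Type*} [NormedAddCommGroup E] [InnerProductSpace ℝ E]
    (p q : ℝ) (X Y : E) :
    ⟪p • X - q • Y, X - Y⟫ =
      (p * ‖X‖ - q * ‖Y‖) * (‖X‖ - ‖Y‖) + (p + q) * (‖X‖ * ‖Y‖ - ⟪X, Y⟫) := by
  simp only [inner_sub_left, inner_sub_right, real_inner_smul_left,
    real_inner_self_eq_norm_sq, real_inner_comm X Y]
  ring

/-- Strict monotonicity of the vector field `A(X) = (φ(‖X‖)/‖X‖)·X` on a real
inner product space, for `φ` vanishing at `0`, positive and strictly increasing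
on `(0,∞)`. -/
theorem strict_monotonicity_of_radial_field
    {E : Type*} [NormedAddCommGroup E] [InnerProductSpace ℝ E]
    (φ : ℝ → ℝ)
    (hφ0 : φ 0 = 0)
    (hφpos : ∀ t : ℝ, 0 < t → 0 < φ t)
    (hφmono : StrictMonoOn φ (Set.Ioi (0 : ℝ)))
    (A : E → E)
    (hA0 : A 0 = 0)
    (hA : ∀ X : E, X ≠ 0 → A X = (φ ‖X‖ / ‖X‖) • X) :
    ∀ X Y : E, X ≠ Y → 0 < ⟪A X - A Y, X - Y⟫ := by
  have hA' : ∀ X : E, A X = (φ ‖X‖ / ‖X‖) • X := fun X => by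
    rcases eq_or_ne X 0 with rfl | hX
    · simp [hA0]
    · exact hA X hX
  have hmono : StrictMonoOn φ (Set.Ici 0) := by
    intro s hs t _ hst
    rcases (Set.mem_Ici.1 hs).eq_or_lt with rfl | hs
    · exact hφ0.trans_lt (hφpos t hst)
    · exact hφmono hs (hs.trans hst) hst
  have hφnonneg : ∀ X : E, 0 ≤ φ ‖X‖ := fun X =>
    hφ0 ▸ hmono.monotoneOn Set.self_mem_Ici (norm_nonneg X) (norm_nonneg X)
  have hφnorm : ∀ X : E, φ ‖X‖ / ‖X‖ * ‖X‖ = φ ‖X‖ := fun X =>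
    div_mul_cancel_of_imp fun h => by rw [h, hφ0]
  intro X Y hXY
  rw [hA' X, hA' Y]
  rcases eq_or_ne ‖X‖ ‖Y‖ with h | h
  · have hY : 0 < ‖Y‖ := by
      refine (norm_nonneg Y).lt_of_ne fun h0 => hXY ?_
      rw [norm_eq_zero.1 h0.symm, norm_eq_zero.1 (h.trans h0.symm)]
    rw [h, ← smul_sub, real_inner_smul_left]
    exact mul_pos (div_pos (hφpos _ hY) hY) (real_inner_self_pos.2 (sub_ne_zero.2 hXY))
  · rw [inner_smul_sub_smul_sub, hφnorm, hφnorm]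
    refine add_pos_of_pos_of_nonneg ?_ (mul_nonneg (add_nonneg ?_ ?_) ?_)
    · rcases h.lt_or_gt with h | h
      · exact mul_pos_of_neg_of_neg
          (sub_neg.2 (hmono (norm_nonneg X) (norm_nonneg Y) h)) (sub_neg.2 h)
      · exact mul_pos (sub_pos.2 (hmono (norm_nonneg Y) (norm_nonneg X) h)) (sub_pos.2 h)
    · exact div_nonneg (hφnonneg X) (norm_nonneg X)
    · exact div_nonneg (hφnonneg Y) (norm_nonneg Y)
    · exact sub_nonneg.2 (real_inner_le_norm X Y)
end

section
/- Let E be a finite-dimensional real inner product space, let h be a symmetric positive-definite bilinear form on E, and let φ : [0,∞) → [0,∞) be continuous with φ(0) = 0, φ > 0 on (0,∞), and φ of class C¹ on (0,∞). Suppose that for every t > 0 and all X, Y ∈ E with ‖X‖ = ‖Y‖ = 1 one has (φ(t)/t)·h(X,X) + (φ'(t) − φ(t)/t)·⟨Y,X⟩·h(Y,X) > 0. Then for all nonzero X, Y ∈ E with X ≠ Y one has (φ(‖X‖)/‖X‖)·h(X, X−Y) − (φ(‖Y‖)/‖Y‖)·h(Y, X−Y) > 0. -/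
open scoped RealInnerProductSpace

theorem HasDerivAt.norm_of_ne_zero {E : Type*} [NormedAddCommGroup E] [InnerProductSpace ℝ E]
    {f : ℝ → E} {f' : E} {s : ℝ} (hf : HasDerivAt f f' s) (h0 : f s ≠ 0) :
    HasDerivAt (fun u => ‖f u‖) (⟪f s, f'⟫ / ‖f s‖) s := by
  have hr : ‖f s‖ ≠ 0 := norm_ne_zero_iff.2 h0
  have key := hf.norm_sq.sqrt (pow_ne_zero 2 hr)
  simp only [Real.sqrt_sq (norm_nonneg _)] at key
  refine key.congr_deriv ?_
  field_simp

/-- The derivative of `s ↦ (φ(‖Z‖)/‖Z‖)·h(Z, V)` along the line `Z = Y + s • V`. -/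
theorem hasDerivAt_radial_mul_bilin {E : Type*} [NormedAddCommGroup E] [InnerProductSpace ℝ E]
    (h : E →ₗ[ℝ] E →ₗ[ℝ] ℝ) {φ : ℝ → ℝ} {Y V : E} {s : ℝ} (h0 : Y + s • V ≠ 0)
    (hφ : DifferentiableAt ℝ φ ‖Y + s • V‖) :
    HasDerivAt (fun u : ℝ => φ ‖Y + u • V‖ / ‖Y + u • V‖ * h (Y + u • V) V)
      (φ ‖Y + s • V‖ / ‖Y + s • V‖ * h V V +
        (deriv φ ‖Y + s • V‖ - φ ‖Y + s • V‖ / ‖Y + s • V‖) *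
          (⟪Y + s • V, V⟫ * h (Y + s • V) V / ‖Y + s • V‖ ^ 2)) s := by
  have hr : ‖Y + s • V‖ ≠ 0 := norm_ne_zero_iff.2 h0
  have hZ : HasDerivAt (fun u : ℝ => Y + u • V) V s := by
    simpa using ((hasDerivAt_id s).smul_const V).const_add Y
  have hh : HasDerivAt (fun u : ℝ => h (Y + u • V) V) (h V V) s := by
    simpa using ((hasDerivAt_id s).mul_const (h V V)).const_add (h Y V)
  have hn := hZ.norm_of_ne_zero h0
  have hc : HasDerivAt (fun u : ℝ => φ ‖Y + u • V‖) _ s := hφ.hasDerivAt.comp s hn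
  refine ((hc.fun_div hn hr).fun_mul hh).congr_deriv ?_
  field_simp
  ring

/-- The sufficient condition (5) of the paper implies the strict monotonicity
inequality (6) for the vector field `X ↦ (φ(‖X‖)/‖X‖)·h(X,·)^♯` associated to
the operator `L_{φ,h}`. -/
theorem monotonicity_inequality_of_sufficient_condition
    {E : Type*} [NormedAddCommGroup E] [InnerProductSpace ℝ E]
    [FiniteDimensional ℝ E]
    (h : E →ₗ[ℝ] E →ₗ[ℝ] ℝ)
    (hsymm : ∀ X Y : E, h X Y = h Y X)
    (hposdef : ∀ X : E, X ≠ 0 → 0 < h X X)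
    (φ : ℝ → ℝ)
    (hφcont : ContinuousOn φ (Set.Ici (0 : ℝ)))
    (hφ0 : φ 0 = 0)
    (hφpos : ∀ t : ℝ, 0 < t → 0 < φ t)
    (hφC1 : ContDiffOn ℝ 1 φ (Set.Ioi (0 : ℝ)))
    (hyp : ∀ t : ℝ, 0 < t → ∀ X Y : E, ‖X‖ = 1 → ‖Y‖ = 1 →
      0 < (φ t / t) * h X X + (deriv φ t - φ t / t) * ⟪Y, X⟫ * h Y X) :
    ∀ X Y : E, X ≠ 0 → Y ≠ 0 → X ≠ Y →
      0 < (φ ‖X‖ / ‖X‖) * h X (X - Y) - (φ ‖Y‖ / ‖Y‖) * h Y (X - Y) := by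
  intro X Y hX hY hXY
  obtain ⟨V, rfl⟩ : ∃ V, X = Y + V := ⟨X - Y, by abel⟩
  have hV : V ≠ 0 := by simpa using hXY
  rw [add_sub_cancel_left]
  by_cases hseg : ∃ s ∈ Set.Icc (0 : ℝ) 1, Y + s • V = 0
  · obtain ⟨s, ⟨hs0, hs1⟩, hs⟩ := hseg
    have hYV : Y = -(s • V) := eq_neg_of_add_eq_zero_left hs
    have hs0' : 0 < s := hs0.lt_of_ne (by rintro rfl; simp_all)
    have hs1' : s < 1 := hs1.lt_of_ne (by rintro rfl; simp_all)
    have e1 : h Y V = -(s * h V V) := by rw [hYV]; simp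
    have e2 : h (Y + V) V = (1 - s) * h V V := by rw [map_add, LinearMap.add_apply, e1]; ring
    have hVV := hposdef V hV
    have p1 : 0 < φ ‖Y + V‖ / ‖Y + V‖ :=
      div_pos (hφpos _ (norm_pos_iff.2 hX)) (norm_pos_iff.2 hX)
    have p2 : 0 < φ ‖Y‖ / ‖Y‖ := div_pos (hφpos _ (norm_pos_iff.2 hY)) (norm_pos_iff.2 hY)
    rw [e1, e2, mul_neg, sub_neg_eq_add]
    have : 0 < 1 - s := sub_pos.2 hs1'
    positivity
  · push Not at hseg
    have hderiv : ∀ s ∈ Set.Icc (0 : ℝ) 1, _ := fun s hs =>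
      hasDerivAt_radial_mul_bilin h (hseg s hs)
        ((hφC1.differentiableOn one_ne_zero).differentiableAt
          (Ioi_mem_nhds (norm_pos_iff.2 (hseg s hs))))
    have hmono := strictMonoOn_of_deriv_pos (convex_Icc (0 : ℝ) 1)
      (fun s hs => (hderiv s hs).continuousAt.continuousWithinAt) (fun s hs => by
        have hs' := interior_subset hs
        rw [(hderiv s hs').deriv]
        have hr : 0 < ‖Y + s • V‖ := norm_pos_iff.2 (hseg s hs')
        have hv : 0 < ‖V‖ := norm_pos_iff.2 hV
        have key := hyp _ hr (‖V‖⁻¹ • V) (‖Y + s • V‖⁻¹ • (Y + s • V))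
          (norm_smul_inv_norm hV) (norm_smul_inv_norm (hseg s hs'))
        generalize Y + s • V = Z at *
        simp only [map_smul, LinearMap.smul_apply, smul_eq_mul, real_inner_smul_left,
          real_inner_smul_right] at key
        refine (mul_pos (pow_pos hv 2) key).trans_eq ?_
        field_simp)
    have := hmono (Set.left_mem_Icc.2 zero_le_one) (Set.right_mem_Icc.2 zero_le_one) zero_lt_one
    simpa using this
end

section
/- Let p > 1, a₁ ≥ 0, a₂ > 0, and let φ satisfy the structural bounds. Let B : ℝ → [0,∞) be continuous, non-decreasing, with B(t) = 0 for t ≤ 0, set β(t) = ∫_0^t B(s) ds, and assume β(s₀) > 0 for some s₀ > 0. Then for every μ ∈ [0,1): ∫_{s₀}^∞ ds / K_μ^{-1}(β(s)) = +∞ if and only if ∫_{s₀}^∞ β(s)^{−1/p} ds = +∞. In particular, the validity of the condition ∫^{+∞} ds / K_μ^{-1}(β(s)) = +∞ is independent of the choice of μ ∈ [0,1). -/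
open intervalIntegral MeasureTheory

lemma intervalIntegrable_mul_deriv_of_bounds {p a₁ a₂ : ℝ} (hp : 1 < p) (ha₂ : 0 < a₂)
    {φ : ℝ → ℝ} (hφC1 : ContDiffOn ℝ 1 φ (Set.Ioi (0 : ℝ)))
    (hbounds : ∀ t : ℝ, 0 < t →
      a₂⁻¹ * t ^ (p - 1) ≤ t * deriv φ t ∧ t * deriv φ t ≤ a₁ + a₂ * t ^ (p - 1))
    {a b : ℝ} (ha : 0 ≤ a) (hab : a ≤ b) :
    IntervalIntegrable (fun s => s * deriv φ s) volume a b := by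
  have hsub : Set.Ioc a b ⊆ Set.Ioi 0 := fun s hs => ha.trans_lt hs.1
  have hcont : ContinuousOn (fun s => s * deriv φ s) (Set.Ioi 0) :=
    continuousOn_id.mul (hφC1.continuousOn_deriv_of_isOpen isOpen_Ioi le_rfl)
  have hg : IntervalIntegrable (fun s : ℝ => a₁ + a₂ * s ^ (p - 1)) volume a b :=
    (intervalIntegrable_const).add
      ((intervalIntegral.intervalIntegrable_rpow' (by linarith)).const_mul _)
  rw [intervalIntegrable_iff_integrableOn_Ioc_of_le hab] at hg ⊢
  refine Integrable.mono' hg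
    ((hcont.mono hsub).aestronglyMeasurable measurableSet_Ioc) ?_
  filter_upwards [ae_restrict_mem measurableSet_Ioc] with s hs
  have hs0 : 0 < s := hsub hs
  have hnn : 0 ≤ s * deriv φ s := le_trans (by positivity) (hbounds s hs0).1
  rw [Real.norm_of_nonneg hnn]
  exact (hbounds s hs0).2

lemma integral_mul_deriv_le {p a₁ a₂ : ℝ} (hp : 1 < p) (ha₁ : 0 ≤ a₁) (ha₂ : 0 < a₂)
    {φ : ℝ → ℝ} (hbounds : ∀ t : ℝ, 0 < t →
      a₂⁻¹ * t ^ (p - 1) ≤ t * deriv φ t ∧ t * deriv φ t ≤ a₁ + a₂ * t ^ (p - 1))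
    {a b : ℝ} (ha : 0 ≤ a) (hab : a ≤ b) :
    ∫ s in a..b, s * deriv φ s ≤ (a₁ + a₂ * b ^ (p - 1)) * b := by
  have hb : 0 ≤ b := ha.trans hab
  have key : ‖∫ s in a..b, s * deriv φ s‖ ≤ (a₁ + a₂ * b ^ (p - 1)) * |b - a| := by
    refine intervalIntegral.norm_integral_le_of_norm_le_const fun s hs => ?_
    rw [Set.uIoc_of_le hab] at hs
    have hs0 : 0 < s := ha.trans_lt hs.1
    have hnn : 0 ≤ s * deriv φ s := le_trans (by positivity) (hbounds s hs0).1
    rw [Real.norm_of_nonneg hnn]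
    refine (hbounds s hs0).2.trans ?_
    have : s ^ (p - 1) ≤ b ^ (p - 1) := Real.rpow_le_rpow hs0.le hs.2 (by linarith)
    gcongr
  rw [abs_of_nonneg (sub_nonneg.2 hab)] at key
  refine (Real.le_norm_self _).trans (key.trans ?_)
  exact mul_le_mul_of_nonneg_left (by linarith) (by positivity)

lemma le_integral_mul_deriv {p a₁ a₂ : ℝ} (hp : 1 < p) (ha₂ : 0 < a₂)
    {φ : ℝ → ℝ} (hφC1 : ContDiffOn ℝ 1 φ (Set.Ioi (0 : ℝ)))
    (hbounds : ∀ t : ℝ, 0 < t →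
      a₂⁻¹ * t ^ (p - 1) ≤ t * deriv φ t ∧ t * deriv φ t ≤ a₁ + a₂ * t ^ (p - 1))
    {a b : ℝ} (ha : 0 ≤ a) (hab : a ≤ b) :
    a₂⁻¹ * ((b ^ p - a ^ p) / p) ≤ ∫ s in a..b, s * deriv φ s := by
  have h1 : ∫ s in a..b, a₂⁻¹ * s ^ (p - 1) = a₂⁻¹ * ((b ^ p - a ^ p) / p) := by
    rw [intervalIntegral.integral_const_mul, integral_rpow (Or.inl (by linarith))]
    simp
  rw [← h1]
  refine intervalIntegral.integral_mono_on_of_le_Ioo hab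
    ((intervalIntegral.intervalIntegrable_rpow' (by linarith)).const_mul _)
    (intervalIntegrable_mul_deriv_of_bounds hp ha₂ hφC1 hbounds ha hab) fun s hs => ?_
  exact (hbounds s (ha.trans_lt hs.1)).1

lemma integral_mul_deriv_mono {p a₁ a₂ : ℝ} (hp : 1 < p) (ha₂ : 0 < a₂)
    {φ : ℝ → ℝ} (hφC1 : ContDiffOn ℝ 1 φ (Set.Ioi (0 : ℝ)))
    (hbounds : ∀ t : ℝ, 0 < t →
      a₂⁻¹ * t ^ (p - 1) ≤ t * deriv φ t ∧ t * deriv φ t ≤ a₁ + a₂ * t ^ (p - 1))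
    {μ a b : ℝ} (hμ : 0 ≤ μ) (ha : μ ≤ a) (hab : a ≤ b) :
    ∫ s in μ..a, s * deriv φ s ≤ ∫ s in μ..b, s * deriv φ s := by
  have ha0 : 0 ≤ a := hμ.trans ha
  rw [← intervalIntegral.integral_add_adjacent_intervals
    (intervalIntegrable_mul_deriv_of_bounds hp ha₂ hφC1 hbounds hμ ha)
    (intervalIntegrable_mul_deriv_of_bounds hp ha₂ hφC1 hbounds ha0 hab)]
  have h := le_integral_mul_deriv hp ha₂ hφC1 hbounds ha0 hab
  have h' : 0 ≤ a₂⁻¹ * ((b ^ p - a ^ p) / p) := by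
    have : a ^ p ≤ b ^ p := Real.rpow_le_rpow ha0 hab (by linarith)
    exact mul_nonneg (by positivity) (div_nonneg (by linarith) (by linarith))
  linarith

lemma one_div_le_mul_rpow_of_le_growth {p a₁ a₂ b : ℝ} (hp : 1 < p) (ha₁ : 0 ≤ a₁)
    (ha₂ : 0 < a₂) (hb : 0 < b) :
    ∃ C : ℝ, ∀ y t : ℝ, b ≤ y → 0 ≤ t → y ≤ (a₁ + a₂ * t ^ (p - 1)) * t →
      0 < t ∧ 1 / t ≤ C * y ^ (-(1 / p)) := by
  obtain ⟨τ, hτ, hτle⟩ : ∃ τ : ℝ, 0 < τ ∧ ∀ y t : ℝ, b ≤ y → 0 ≤ t →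
      y ≤ (a₁ + a₂ * t ^ (p - 1)) * t → τ ≤ t := by
    refine ⟨min 1 (b / (a₁ + a₂)), by positivity, fun y t hy ht hyt => ?_⟩
    by_cases h1 : 1 ≤ t
    · exact (min_le_left _ _).trans h1
    · refine (min_le_right _ _).trans ?_
      rw [div_le_iff₀ (by positivity), mul_comm]
      have : t ^ (p - 1) ≤ 1 := Real.rpow_le_one ht (le_of_not_ge h1) (by linarith)
      refine hy.trans (hyt.trans ?_)
      gcongr
      nlinarith
  refine ⟨(a₁ * (τ ^ (p - 1))⁻¹ + a₂) ^ (1 / p), fun y t hy ht hyt => ?_⟩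
  have htτ := hτle y t hy ht hyt
  have ht0 : 0 < t := hτ.trans_le htτ
  have hy0 : 0 < y := hb.trans_le hy
  refine ⟨ht0, ?_⟩
  have hpow : τ ^ (p - 1) ≤ t ^ (p - 1) := Real.rpow_le_rpow hτ.le htτ (by linarith)
  have htp : t ^ p = t ^ (p - 1) * t := by
    rw [← Real.rpow_add_one ht0.ne']; simp
  have hτp : 0 < τ ^ (p - 1) := by positivity
  have hbound : y ≤ (a₁ * (τ ^ (p - 1))⁻¹ + a₂) * t ^ p := by
    refine hyt.trans ?_
    rw [htp, ← mul_assoc]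
    gcongr
    rw [add_mul]
    gcongr
    rw [mul_assoc]
    refine le_mul_of_one_le_right ha₁ ?_
    rw [inv_mul_eq_div, one_le_div hτp]
    exact hpow
  have hroot : y ^ (1 / p) ≤ (a₁ * (τ ^ (p - 1))⁻¹ + a₂) ^ (1 / p) * t := by
    have h := Real.rpow_le_rpow hy0.le hbound (show 0 ≤ 1 / p by positivity)
    rwa [Real.mul_rpow (by positivity) (by positivity), ← Real.rpow_mul ht0.le,
      mul_one_div_cancel (by linarith), Real.rpow_one] at h
  rw [Real.rpow_neg hy0.le, ← div_eq_mul_inv, div_le_div_iff₀ ht0 (by positivity)]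
  linarith

lemma rpow_le_mul_one_div_of_growth_le {p a₂ b : ℝ} (hp : 1 < p) (ha₂ : 0 < a₂) (hb : 0 < b)
    {μ : ℝ} (hμ : 0 ≤ μ) (hμ1 : μ ≤ 1) :
    ∃ C : ℝ, ∀ y t : ℝ, b ≤ y → 0 < t → a₂⁻¹ * ((t ^ p - μ ^ p) / p) ≤ y →
      y ^ (-(1 / p)) ≤ C * (1 / t) := by
  refine ⟨(b⁻¹ + a₂ * p) ^ (1 / p), fun y t hy ht hyt => ?_⟩
  have hp0 : 0 < p := by linarith
  have hy0 : 0 < y := hb.trans_le hy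
  have hμp : μ ^ p ≤ 1 := Real.rpow_le_one hμ hμ1 hp0.le
  have hbound : t ^ p ≤ (b⁻¹ + a₂ * p) * y := by
    rw [inv_mul_le_iff₀ ha₂, div_le_iff₀ hp0] at hyt
    have : 1 ≤ b⁻¹ * y := by rwa [inv_mul_eq_div, one_le_div hb]
    nlinarith
  have hroot : t ≤ (b⁻¹ + a₂ * p) ^ (1 / p) * y ^ (1 / p) := by
    have h := Real.rpow_le_rpow (by positivity) hbound (show 0 ≤ 1 / p by positivity)
    rwa [Real.mul_rpow (by positivity) hy0.le, ← Real.rpow_mul ht.le,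
      mul_one_div_cancel hp0.ne', Real.rpow_one] at h
  rw [Real.rpow_neg hy0.le, mul_one_div, le_div_iff₀ ht, inv_mul_le_iff₀ (by positivity)]
  linarith

/-- The negated Keller–Osserman condition `∫^∞ ds / K_μ⁻¹(β(s)) = +∞` is
equivalent to the simplified condition `∫^∞ β(s)^(-1/p) ds = +∞`, for every
`μ ∈ [0,1)`; in particular its validity is independent of `μ`. Divergence of
the integral of these (nonnegative) functions is expressed as
non-integrability on `[s₀,∞)`. -/
theorem kellerOsserman_independent_of_mu
    (p a₁ a₂ : ℝ) (hp : 1 < p) (ha₁ : 0 ≤ a₁) (ha₂ : 0 < a₂)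
    (φ : ℝ → ℝ)
    (hφC1 : ContDiffOn ℝ 1 φ (Set.Ioi (0 : ℝ)))
    (hbounds : ∀ t : ℝ, 0 < t →
      a₂⁻¹ * t ^ (p - 1) ≤ t * deriv φ t ∧ t * deriv φ t ≤ a₁ + a₂ * t ^ (p - 1))
    (B : ℝ → ℝ)
    (hBcont : Continuous B)
    (hBnonneg : ∀ t : ℝ, 0 ≤ B t)
    (hBmono : Monotone B)
    (hBzero : ∀ t : ℝ, t ≤ 0 → B t = 0)
    (s₀ : ℝ) (hs₀ : 0 < s₀)
    (hβpos : 0 < ∫ u in (0:ℝ)..s₀, B u)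
    -- `Kinv μ` is the inverse of the bijection `K_μ : [μ,∞) → [0,∞)`,
    -- `K_μ(t) = ∫_μ^t s φ'(s) ds`
    (Kinv : ℝ → ℝ → ℝ)
    (hKinv_left : ∀ μ ∈ Set.Ico (0 : ℝ) 1, ∀ t : ℝ, μ ≤ t →
      Kinv μ (∫ s in μ..t, s * deriv φ s) = t)
    (hKinv_right : ∀ μ ∈ Set.Ico (0 : ℝ) 1, ∀ s : ℝ, 0 ≤ s →
      μ ≤ Kinv μ s ∧ (∫ u in μ..(Kinv μ s), u * deriv φ u) = s) :
    ∀ μ ∈ Set.Ico (0 : ℝ) 1,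
      (¬ IntegrableOn (fun s : ℝ => 1 / Kinv μ (∫ u in (0:ℝ)..s, B u))
          (Set.Ici s₀)) ↔
      (¬ IntegrableOn (fun s : ℝ => (∫ u in (0:ℝ)..s, B u) ^ (-(1 / p)))
          (Set.Ici s₀)) := by
  rintro μ hμ
  obtain ⟨hμ0, hμ1⟩ := hμ
  set β : ℝ → ℝ := fun s => ∫ u in (0:ℝ)..s, B u with hβ
  have hβmono : Monotone β := fun x y hxy => by
    have h : β y - β x = ∫ u in x..y, B u :=
      intervalIntegral.integral_interval_sub_left (hBcont.intervalIntegrable _ _)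
        (hBcont.intervalIntegrable _ _)
    have h' := intervalIntegral.integral_nonneg (μ := volume) hxy fun u _ => hBnonneg u
    linarith
  have hβge : ∀ s ∈ Set.Ici s₀, β s₀ ≤ β s := fun s hs => hβmono hs
  have hKmono : MonotoneOn (Kinv μ) (Set.Ici 0) := by
    intro x hx y hy hxy
    by_contra! hlt
    obtain ⟨-, hxK⟩ := hKinv_right μ ⟨hμ0, hμ1⟩ x hx
    obtain ⟨hyμ, hyK⟩ := hKinv_right μ ⟨hμ0, hμ1⟩ y hy
    have h := integral_mul_deriv_mono hp ha₂ hφC1 hbounds hμ0 hyμ hlt.le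
    rw [hxK, hyK] at h
    rw [le_antisymm hxy h] at hlt
    exact lt_irrefl _ hlt
  obtain ⟨C, hC⟩ := one_div_le_mul_rpow_of_le_growth hp ha₁ ha₂ hβpos
  obtain ⟨D, hD⟩ := rpow_le_mul_one_div_of_growth_le hp ha₂ hβpos hμ0 hμ1.le
  have hupper : ∀ s ∈ Set.Ici s₀, 0 < Kinv μ (β s) ∧
      1 / Kinv μ (β s) ≤ C * β s ^ (-(1 / p)) := fun s hs => by
    obtain ⟨hle, hK⟩ := hKinv_right μ ⟨hμ0, hμ1⟩ (β s) (hβpos.le.trans (hβge s hs))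
    refine hC _ _ (hβge s hs) (hμ0.trans hle) ?_
    conv_lhs => rw [← hK]
    exact integral_mul_deriv_le hp ha₁ ha₂ hbounds hμ0 hle
  have hlower : ∀ s ∈ Set.Ici s₀, β s ^ (-(1 / p)) ≤ D * (1 / Kinv μ (β s)) := fun s hs => by
    obtain ⟨hle, hK⟩ := hKinv_right μ ⟨hμ0, hμ1⟩ (β s) (hβpos.le.trans (hβge s hs))
    refine hD _ _ (hβge s hs) (hupper s hs).1 ?_
    conv_rhs => rw [← hK]
    exact le_integral_mul_deriv hp ha₂ hφC1 hbounds hμ0 hle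
  refine not_congr ⟨fun h => ?_, fun h => ?_⟩
  · refine Integrable.mono' (h.const_mul D) ?_ ?_
    · exact (hβmono.measurable.pow_const _).aestronglyMeasurable
    · filter_upwards [ae_restrict_mem measurableSet_Ici] with s hs
      rw [Real.norm_of_nonneg (Real.rpow_nonneg (hβpos.le.trans (hβge s hs)) _)]
      exact hlower s hs
  · refine Integrable.mono' (h.const_mul C) ?_ ?_
    · refine (aemeasurable_restrict_of_antitoneOn measurableSet_Ici
        fun x hx y hy hxy => ?_).aestronglyMeasurable
      exact one_div_le_one_div_of_le (hupper x hx).1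
        (hKmono (hβpos.le.trans (hβge x hx)) (hβpos.le.trans (hβge y hy)) (hβmono hxy))
    · filter_upwards [ae_restrict_mem measurableSet_Ici] with s hs
      rw [Real.norm_of_nonneg (one_div_nonneg.2 (hupper s hs).1.le)]
      exact (hupper s hs).2
end

section
/- Fix ε > 0 and θ ≥ 0, and let T be the Volterra operator defined for r ∈ (R, R+1) on continuous functions on [R,r] by T u(t) = θ + (1/c) ∫_R^t φ⁻¹( g(R)^{m−1} φ(cμ) / g(s)^{m−1} + ∫_R^s (g(τ)^{m−1} / g(s)^{m−1}) B(c u(τ)) dτ ) ds. Then: (i) there exists r₀ ∈ (R, R+1) such that for every r ∈ (R, r₀], T maps the closed ball A_ε = { u ∈ C⁰([R,r]) : ‖u − θ‖_{L^∞} ≤ ε } into itself; and (ii) there exists a constant C > 0, independent of r ∈ (R, R+1), such that for every u ∈ A_ε and all s, t ∈ [R,r] one has |T u(t) − T u(s)| ≤ C |t − s|. -/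
open intervalIntegral

/-- The Volterra operator
`T u(t) = θ + (1/c) ∫_R^t φ⁻¹( g(R)^(m-1) φ(cμ)/g(s)^(m-1)
          + ∫_R^s (g(τ)^(m-1)/g(s)^(m-1)) B(c u(τ)) dτ ) ds`. -/
noncomputable def volterraOp (θ c μ R : ℝ) (m : ℕ) (g φ φinv B : ℝ → ℝ)
    (u : ℝ → ℝ) (t : ℝ) : ℝ :=
  θ + (1 / c) * ∫ s in R..t,
    φinv (g R ^ (m - 1) * φ (c * μ) / g s ^ (m - 1)
      + ∫ τ in R..s, (g τ ^ (m - 1) / g s ^ (m - 1)) * B (c * u τ))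

/-- A right inverse on `[0,∞)` of a strictly increasing function is monotone there. -/
lemma monotoneOn_of_strictMonoOn_rightInverse {φ φinv : ℝ → ℝ}
    (hφmono : StrictMonoOn φ (Set.Ici (0 : ℝ)))
    (hright : ∀ s : ℝ, 0 ≤ s → 0 ≤ φinv s ∧ φ (φinv s) = s) :
    MonotoneOn φinv (Set.Ici (0 : ℝ)) := by
  intro x hx y hy hxy
  by_contra! h
  have := hφmono (hright y hy).1 (hright x hx).1 h
  rw [(hright y hy).2, (hright x hx).2] at this
  linarith

/-- The composition of a function monotone on `[0,∞)` with a nonnegative function that is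
continuous on a compact interval is integrable on that interval. -/
lemma MonotoneOn.integrableOn_comp_continuousOn {ψ F : ℝ → ℝ} {a b : ℝ}
    (hψ : MonotoneOn ψ (Set.Ici (0 : ℝ))) (hF : ContinuousOn F (Set.Icc a b))
    (hF0 : ∀ s ∈ Set.Icc a b, 0 ≤ F s) :
    MeasureTheory.IntegrableOn (fun s => ψ (F s)) (Set.Icc a b) := by
  obtain ⟨K, hK⟩ := isCompact_Icc.bddAbove_image hF
  have hψ' : Monotone fun x => ψ (max x 0) := fun x y hxy =>
    hψ (le_max_right x 0) (le_max_right y 0) (max_le_max_right 0 hxy)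
  have hmeas : AEMeasurable (fun s => ψ (max (F s) 0))
      (MeasureTheory.volume.restrict (Set.Icc a b)) :=
    hψ'.measurable.comp_aemeasurable (hF.aemeasurable measurableSet_Icc)
  have hint : MeasureTheory.IntegrableOn (fun s => ψ (max (F s) 0)) (Set.Icc a b) := by
    refine MeasureTheory.IntegrableOn.of_bound isCompact_Icc.measure_lt_top
      hmeas.aestronglyMeasurable (max |ψ 0| |ψ (max K 0)|) ?_
    filter_upwards [MeasureTheory.ae_restrict_mem measurableSet_Icc] with s hs
    have h0 : ψ 0 ≤ ψ (max (F s) 0) :=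
      hψ Set.self_mem_Ici (Set.mem_Ici.2 (le_max_right _ _)) (le_max_right _ _)
    have h1 : ψ (max (F s) 0) ≤ ψ (max K 0) :=
      hψ' (hK (Set.mem_image_of_mem F hs))
    rw [Real.norm_eq_abs]
    exact abs_le_max_abs_abs h0 h1
  refine hint.congr_fun (fun s hs => ?_) measurableSet_Icc
  simp only [max_eq_left (hF0 s hs)]

/-- The Volterra operator maps the ball of radius `ε` about `θ` to uniformly Lipschitz
functions. -/
lemma exists_volterraOp_lipschitz
    {R : ℝ} {m : ℕ} {c : ℝ} (hc : 0 < c) {μ : ℝ} (hμ : 0 < μ)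
    {g : ℝ → ℝ} (hgcont : ContinuousOn g (Set.Ici R))
    (hgpos : ∀ t ∈ Set.Ici R, 0 < g t)
    {φ : ℝ → ℝ} (hφmono : StrictMonoOn φ (Set.Ici (0 : ℝ))) (hφ0 : φ 0 = 0)
    {φinv : ℝ → ℝ} (hφinv_right : ∀ s : ℝ, 0 ≤ s → 0 ≤ φinv s ∧ φ (φinv s) = s)
    {B : ℝ → ℝ} (hBcont : Continuous B) (hBnonneg : ∀ t : ℝ, 0 ≤ B t)
    (hBmono : Monotone B) (ε θ : ℝ) :
    ∃ C : ℝ, 0 < C ∧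
      ∀ r ∈ Set.Ioo R (R + 1), ∀ u : ℝ → ℝ,
        ContinuousOn u (Set.Icc R r) →
        (∀ t ∈ Set.Icc R r, |u t - θ| ≤ ε) →
        ∀ s ∈ Set.Icc R r, ∀ t ∈ Set.Icc R r,
          |volterraOp θ c μ R m g φ φinv B u t
            - volterraOp θ c μ R m g φ φinv B u s| ≤ C * |t - s| := by
  have hinv := monotoneOn_of_strictMonoOn_rightInverse hφmono hφinv_right
  have hGcont : ContinuousOn (fun s => g s ^ (m - 1)) (Set.Icc R (R + 1)) :=
    (hgcont.mono Set.Icc_subset_Ici_self).pow _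
  have hGpos : ∀ s ∈ Set.Icc R (R + 1), 0 < g s ^ (m - 1) := fun s hs =>
    pow_pos (hgpos s hs.1) _
  have hne : (Set.Icc R (R + 1)).Nonempty := Set.nonempty_Icc.2 (by linarith)
  obtain ⟨x₀, hx₀, hmin⟩ := isCompact_Icc.exists_isMinOn hne hGcont
  obtain ⟨x₁, hx₁, hmax⟩ := isCompact_Icc.exists_isMaxOn hne hGcont
  set a := g x₀ ^ (m - 1)
  set b := g x₁ ^ (m - 1)
  have ha : 0 < a := hGpos x₀ hx₀
  have hb : 0 < b := hGpos x₁ hx₁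
  have hφpos : 0 < φ (c * μ) := by
    rw [← hφ0]
    exact hφmono Set.self_mem_Ici (mul_pos hc hμ).le (mul_pos hc hμ)
  set N := B (c * (θ + ε))
  have hN : 0 ≤ N := hBnonneg _
  set K := b * φ (c * μ) / a + b / a * N
  have hK : 0 ≤ K := by positivity
  have hM : 0 ≤ φinv K := (hφinv_right K hK).1
  refine ⟨1 / c * (φinv K + 1), by positivity, fun r hr u hu hball => ?_⟩
  have hsub : Set.Icc R r ⊆ Set.Icc R (R + 1) := Set.Icc_subset_Icc_right hr.2.le
  have hRr : R ∈ Set.Icc R r := Set.left_mem_Icc.2 hr.1.le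
  set F : ℝ → ℝ := fun s => g R ^ (m - 1) * φ (c * μ) / g s ^ (m - 1)
      + ∫ τ in R..s, (g τ ^ (m - 1) / g s ^ (m - 1)) * B (c * u τ) with hFdef
  have hFcont : ContinuousOn F (Set.Icc R r) := by
    have hprim : ContinuousOn (fun s => ∫ τ in R..s, g τ ^ (m - 1) * B (c * u τ))
        (Set.Icc R r) := by
      have hcont : ContinuousOn (fun τ => g τ ^ (m - 1) * B (c * u τ)) (Set.Icc R r) :=
        (hGcont.mono hsub).mul (hBcont.comp_continuousOn (continuousOn_const.mul hu))
      rw [← Set.uIcc_of_le hr.1.le] at hcont ⊢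
      exact continuousOn_primitive_interval (hcont.integrableOn_compact isCompact_uIcc)
    have hGne : ∀ s ∈ Set.Icc R r, g s ^ (m - 1) ≠ 0 := fun s hs => (hGpos s (hsub hs)).ne'
    refine ((continuousOn_const (c := g R ^ (m - 1) * φ (c * μ))).div
      (hGcont.mono hsub) hGne |>.add (hprim.div (hGcont.mono hsub) hGne)).congr fun s _ => ?_
    simp only [hFdef, Pi.add_apply, Pi.div_apply]
    congr 1
    rw [← integral_div]
    congr 1 with τ
    ring
  have hkernel : ∀ s ∈ Set.Icc R r, ∀ τ ∈ Set.Icc R r,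
      0 ≤ (g τ ^ (m - 1) / g s ^ (m - 1)) * B (c * u τ) ∧
        (g τ ^ (m - 1) / g s ^ (m - 1)) * B (c * u τ) ≤ b / a * N := by
    intro s hs τ hτ
    have hs0 := hGpos s (hsub hs)
    have hτ0 := hGpos τ (hsub hτ)
    have hsa : a ≤ g s ^ (m - 1) := hmin (hsub hs)
    have hτb : g τ ^ (m - 1) ≤ b := hmax (hsub hτ)
    have huB : B (c * u τ) ≤ N := by
      refine hBmono (mul_le_mul_of_nonneg_left ?_ hc.le)
      linarith [(abs_le.1 (hball τ hτ)).2]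
    have hB0 := hBnonneg (c * u τ)
    exact ⟨by positivity, by gcongr⟩
  have hFbound : ∀ s ∈ Set.Icc R r, 0 ≤ F s ∧ F s ≤ K := by
    intro s hs
    have hs0 := hGpos s (hsub hs)
    have hR0 := hGpos R (hsub hRr)
    have hsa : a ≤ g s ^ (m - 1) := hmin (hsub hs)
    have hRb : g R ^ (m - 1) ≤ b := hmax (hsub hRr)
    have hτ : ∀ τ ∈ Set.Icc R s, τ ∈ Set.Icc R r := fun τ hτ => ⟨hτ.1, hτ.2.trans hs.2⟩
    have hI0 : 0 ≤ ∫ τ in R..s, (g τ ^ (m - 1) / g s ^ (m - 1)) * B (c * u τ) :=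
      integral_nonneg hs.1 fun τ h => (hkernel s hs τ (hτ τ h)).1
    have hI1 : ∫ τ in R..s, (g τ ^ (m - 1) / g s ^ (m - 1)) * B (c * u τ) ≤ b / a * N := by
      have h := norm_integral_le_of_norm_le_const (a := R) (b := s) (C := b / a * N)
        (f := fun τ => (g τ ^ (m - 1) / g s ^ (m - 1)) * B (c * u τ)) (fun τ h => by
          rw [Set.uIoc_of_le hs.1] at h
          have h' := hkernel s hs τ (hτ τ ⟨h.1.le, h.2⟩)
          rw [Real.norm_of_nonneg h'.1]
          exact h'.2)
      rw [Real.norm_of_nonneg hI0, abs_of_nonneg (by linarith [hs.1])] at h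
      exact h.trans (mul_le_of_le_one_right (by positivity) (by linarith [hs.2, hr.2]))
    refine ⟨by positivity, add_le_add ?_ hI1⟩
    gcongr
  have hint : MeasureTheory.IntegrableOn (fun s => φinv (F s)) (Set.Icc R r) :=
    hinv.integrableOn_comp_continuousOn hFcont fun s hs => (hFbound s hs).1
  have hii : ∀ t ∈ Set.Icc R r,
      IntervalIntegrable (fun s => φinv (F s)) MeasureTheory.volume R t := fun t ht =>
    (intervalIntegrable_iff_integrableOn_Icc_of_le ht.1).2
      (hint.mono_set (Set.Icc_subset_Icc_right ht.2))
  intro s hs t ht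
  have hdiff : volterraOp θ c μ R m g φ φinv B u t - volterraOp θ c μ R m g φ φinv B u s
      = 1 / c * ∫ x in s..t, φinv (F x) := by
    rw [← integral_interval_sub_left (hii t ht) (hii s hs)]
    simp only [volterraOp, hFdef]
    ring
  rw [hdiff, abs_mul, abs_of_pos (by positivity : 0 < 1 / c), mul_assoc]
  refine mul_le_mul_of_nonneg_left ?_ (by positivity)
  rw [← Real.norm_eq_abs]
  refine norm_integral_le_of_norm_le_const fun x hx => ?_
  have hx' : x ∈ Set.Icc R r := Set.uIcc_subset_Icc hs ht (Set.uIoc_subset_uIcc hx)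
  obtain ⟨h0, h1⟩ := hFbound x hx'
  rw [Real.norm_of_nonneg (hφinv_right _ h0).1]
  linarith [hinv h0 hK h1]

/-- Properties (i) and (ii) in the Schauder fixed point argument:
(i) for `r` close enough to `R`, the Volterra operator maps the ball
`A_ε = {u : ‖u - θ‖_∞ ≤ ε}` of `C⁰([R,r])` into itself;
(ii) a Lipschitz estimate `|Tu(t) - Tu(s)| ≤ C|t-s|` with `C` independent of
`r ∈ (R, R+1)` and of `u ∈ A_ε`. -/
theorem volterra_selfmap_and_equicontinuity
    (R : ℝ) (hR : 0 < R) (m : ℕ) (hm : 2 ≤ m)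
    (c : ℝ) (hc : 0 < c) (hc1 : c ≤ 1)
    (μ : ℝ) (hμ : 0 < μ)
    (g : ℝ → ℝ) (hgcont : ContinuousOn g (Set.Ici R))
    (hgpos : ∀ t ∈ Set.Ici R, 0 < g t)
    (φ : ℝ → ℝ) (hφcont : ContinuousOn φ (Set.Ici (0 : ℝ)))
    (hφmono : StrictMonoOn φ (Set.Ici (0 : ℝ))) (hφ0 : φ 0 = 0)
    (φinv : ℝ → ℝ)
    (hφinv_left : ∀ t : ℝ, 0 ≤ t → φinv (φ t) = t)
    (hφinv_right : ∀ s : ℝ, 0 ≤ s → 0 ≤ φinv s ∧ φ (φinv s) = s)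
    (B : ℝ → ℝ) (hBcont : Continuous B) (hBnonneg : ∀ t : ℝ, 0 ≤ B t)
    (hBmono : Monotone B) (hBzero : ∀ t : ℝ, t ≤ 0 → B t = 0)
    (ε : ℝ) (hε : 0 < ε) (θ : ℝ) (hθ : 0 ≤ θ) :
    -- (i) self-mapping of the ball `A_ε` for `r` close to `R`
    (∃ r₀ : ℝ, R < r₀ ∧ r₀ < R + 1 ∧
      ∀ r ∈ Set.Ioc R r₀, ∀ u : ℝ → ℝ,
        ContinuousOn u (Set.Icc R r) →
        (∀ t ∈ Set.Icc R r, |u t - θ| ≤ ε) →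
        (∀ t ∈ Set.Icc R r, |volterraOp θ c μ R m g φ φinv B u t - θ| ≤ ε)) ∧
    -- (ii) uniform Lipschitz estimate
    (∃ C : ℝ, 0 < C ∧
      ∀ r ∈ Set.Ioo R (R + 1), ∀ u : ℝ → ℝ,
        ContinuousOn u (Set.Icc R r) →
        (∀ t ∈ Set.Icc R r, |u t - θ| ≤ ε) →
        ∀ s ∈ Set.Icc R r, ∀ t ∈ Set.Icc R r,
          |volterraOp θ c μ R m g φ φinv B u t
            - volterraOp θ c μ R m g φ φinv B u s| ≤ C * |t - s|) := by
  obtain ⟨C, hC, hlip⟩ := exists_volterraOp_lipschitz (m := m) hc hμ hgcont hgpos hφmono hφ0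
    hφinv_right hBcont hBnonneg hBmono ε θ
  refine ⟨⟨R + min (1 / 2) (ε / C), ?_, ?_, fun r hr u hu hball t ht => ?_⟩, C, hC, hlip⟩
  · linarith [lt_min (one_half_pos (α := ℝ)) (div_pos hε hC)]
  · linarith [min_le_left (1 / 2) (ε / C)]
  · have hr1 : r < R + 1 := by linarith [hr.2, min_le_left (1 / 2) (ε / C)]
    have h := hlip r ⟨hr.1, hr1⟩ u hu hball R (Set.left_mem_Icc.2 hr.1.le) t ht
    have hstart : volterraOp θ c μ R m g φ φinv B u R = θ := by simp [volterraOp]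
    rw [hstart, abs_of_nonneg (sub_nonneg.2 ht.1)] at h
    refine h.trans ?_
    rw [mul_comm, ← le_div_iff₀ hC]
    linarith [ht.2, hr.2, min_le_right (1 / 2) (ε / C)]
end

section
/- For every θ ≥ 0, every c ∈ (0,1] and every μ > 0, there exist ρ ∈ (R, +∞] and a C¹ function z : [R,ρ) → ℝ such that z(R) = θ, z'(R) = μ, z'(t) > 0 for all t ∈ [R,ρ) (so z is positive for t > R and strictly increasing), z satisfies g(t)^{m−1} φ(c z'(t)) = g(R)^{m−1} φ(c μ) + ∫_R^t g(s)^{m−1} B(c z(s)) ds for all t ∈ [R,ρ), and moreover either ρ = +∞ or lim_{t → ρ⁻} z(t) = +∞. -/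
open intervalIntegral

/-- `z` (with derivative `z'`) is a positive, strictly increasing `C¹` solution
of the Cauchy problem (6.5) on the interval `S` (with left endpoint `R`):
`[g^(m-1) φ(c|z'|) sgn(z')]' = g^(m-1) B(cz)`, `z(R) = θ`, `z'(R) = μ`,
written in integrated form. -/
def IsCauchySolution (R : ℝ) (m : ℕ) (c μ θ : ℝ) (g φ B : ℝ → ℝ)
    (S : Set ℝ) (z z' : ℝ → ℝ) : Prop :=
  z R = θ ∧ z' R = μ ∧
  ContinuousOn z' S ∧
  (∀ t ∈ S, 0 < z' t) ∧
  (∀ t ∈ S, HasDerivWithinAt z (z' t) S t) ∧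
  StrictMonoOn z S ∧
  (∀ t ∈ S,
    g t ^ (m - 1) * φ (c * z' t)
      = g R ^ (m - 1) * φ (c * μ) + ∫ s in R..t, g s ^ (m - 1) * B (c * z s))

open Set Filter Topology MeasureTheory

namespace MonotoneCauchy

/-- Admissible coefficients of the integrated Cauchy problem
`z' = p ((K + ∫ h * b (z)) / h)`. -/
structure Admissible (h p b : ℝ → ℝ) : Prop where
  h_cont : Continuous h
  h_pos : ∀ t, 0 < h t
  p_cont : Continuous p
  p_mono : Monotone p
  p_pos : ∀ x, 0 < x → 0 < p x
  b_cont : Continuous b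
  b_nonneg : ∀ x, 0 ≤ b x
  b_mono : Monotone b

/-- The weighted flux `K + ∫_R^t h * b (z)`. -/
noncomputable def flux (R K : ℝ) (h b z : ℝ → ℝ) (t : ℝ) : ℝ :=
  K + ∫ s in R..t, h s * b (z s)

/-- The derivative prescribed by the profile `z`. -/
noncomputable def speed (R K : ℝ) (h p b z : ℝ → ℝ) (t : ℝ) : ℝ :=
  p (flux R K h b z t / h t)

/-- Picard iterates of the integrated Cauchy problem, starting from the constant `θ`. -/
noncomputable def iter (R K θ : ℝ) (h p b : ℝ → ℝ) : ℕ → ℝ → ℝ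
  | 0 => fun _ => θ
  | n + 1 => fun t => θ + ∫ s in R..t, speed R K h p b (iter R K θ h p b n) s

section

variable {R K θ : ℝ} {h p b : ℝ → ℝ}

theorem continuous_flux (H : Admissible h p b) {z : ℝ → ℝ} (hz : Continuous z) :
    Continuous (flux R K h b z) :=
  continuous_const.add (intervalIntegral.continuous_primitive
    (fun _ _ => (H.h_cont.mul (H.b_cont.comp hz)).intervalIntegrable _ _) R)

theorem continuous_speed (H : Admissible h p b) {z : ℝ → ℝ} (hz : Continuous z) :
    Continuous (speed R K h p b z) :=
  H.p_cont.comp ((continuous_flux H hz).div H.h_cont fun t => (H.h_pos t).ne')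

theorem continuous_iter (H : Admissible h p b) (n : ℕ) :
    Continuous (iter R K θ h p b n) := by
  induction n with
  | zero => exact continuous_const
  | succ n ih =>
    exact continuous_const.add (intervalIntegral.continuous_primitive
      (fun _ _ => (continuous_speed H ih).intervalIntegrable _ _) R)

theorem le_flux (H : Admissible h p b) (z : ℝ → ℝ) {t : ℝ} (ht : R ≤ t) :
    K ≤ flux R K h b z t :=
  le_add_of_nonneg_right (intervalIntegral.integral_nonneg ht
    fun s _ => mul_nonneg (H.h_pos s).le (H.b_nonneg _))

theorem speed_pos (H : Admissible h p b) (hK : 0 < K) (z : ℝ → ℝ) {t : ℝ} (ht : R ≤ t) :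
    0 < speed R K h p b z t :=
  H.p_pos _ (div_pos (hK.trans_le (le_flux H z ht)) (H.h_pos t))

theorem flux_mono (H : Admissible h p b) {u v : ℝ → ℝ} (hu : Continuous u) (hv : Continuous v)
    {s t : ℝ} (hs : R ≤ s) (hst : s ≤ t) (huv : ∀ x ∈ Icc R s, u x ≤ v x) :
    flux R K h b u s ≤ flux R K h b v t := by
  have hi : ∀ {w : ℝ → ℝ}, Continuous w → ∀ x y : ℝ,
      IntervalIntegrable (fun s => h s * b (w s)) volume x y :=
    fun hw _ _ => (H.h_cont.mul (H.b_cont.comp hw)).intervalIntegrable _ _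
  have h1 : ∫ x in R..s, h x * b (u x) ≤ ∫ x in R..s, h x * b (v x) :=
    intervalIntegral.integral_mono_on hs (hi hu _ _) (hi hv _ _)
      fun x hx => mul_le_mul_of_nonneg_left (H.b_mono (huv x hx)) (H.h_pos x).le
  have h2 : 0 ≤ ∫ x in s..t, h x * b (v x) :=
    intervalIntegral.integral_nonneg hst fun x _ => mul_nonneg (H.h_pos x).le (H.b_nonneg _)
  have h3 := intervalIntegral.integral_add_adjacent_intervals (hi hv R s) (hi hv s t)
  unfold flux
  linarith

theorem speed_le (H : Admissible h p b) {u v : ℝ → ℝ} (hu : Continuous u) (hv : Continuous v)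
    {s t : ℝ} (hs : R ≤ s) (hst : s ≤ t) (huv : ∀ x ∈ Icc R s, u x ≤ v x) :
    speed R K h p b u s ≤ p (flux R K h b v t / h s) :=
  H.p_mono (div_le_div_of_nonneg_right (flux_mono H hu hv hs hst huv) (H.h_pos s).le)

theorem iter_sub (H : Admissible h p b) (n : ℕ) (s t : ℝ) :
    iter R K θ h p b (n + 1) t - iter R K θ h p b (n + 1) s
      = ∫ x in s..t, speed R K h p b (iter R K θ h p b n) x := by
  have hi : ∀ x y : ℝ, IntervalIntegrable (speed R K h p b (iter R K θ h p b n)) volume x y :=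
    fun _ _ => (continuous_speed H (continuous_iter H n)).intervalIntegrable _ _
  rw [← intervalIntegral.integral_interval_sub_left (hi R t) (hi R s)]
  simp only [iter]
  ring

theorem monotoneOn_iter (H : Admissible h p b) (hK : 0 < K) (n : ℕ) :
    MonotoneOn (iter R K θ h p b n) (Ici R) := by
  intro s hs t _ hst
  cases n with
  | zero => exact le_rfl
  | succ n =>
    rw [← sub_nonneg, iter_sub H]
    exact intervalIntegral.integral_nonneg hst
      fun x hx => (speed_pos H hK _ (le_trans hs hx.1)).le

theorem iter_le_succ (H : Admissible h p b) (hK : 0 < K) (n : ℕ) {t : ℝ} (ht : R ≤ t) :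
    iter R K θ h p b n t ≤ iter R K θ h p b (n + 1) t := by
  induction n generalizing t with
  | zero =>
    exact le_add_of_nonneg_right
      (intervalIntegral.integral_nonneg ht fun x hx => (speed_pos H hK _ hx.1).le)
  | succ n ih =>
    have hc := fun n => continuous_speed (R := R) (K := K) H
      (continuous_iter (R := R) (K := K) (θ := θ) H n)
    exact add_le_add_right (intervalIntegral.integral_mono_on ht
      ((hc n).intervalIntegrable _ _) ((hc (n + 1)).intervalIntegrable _ _)
      fun x hx => speed_le H (continuous_iter H n) (continuous_iter H (n + 1)) hx.1 le_rfl
        fun y hy => ih hy.1) θ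

/-- A uniform bound on the iterates at a point propagates to the right of that point. -/
theorem exists_gt_iter_le (H : Admissible h p b) (hK : 0 < K) {a M : ℝ} (ha : R ≤ a)
    (hM : ∀ n, iter R K θ h p b n a ≤ M) :
    ∃ d, a < d ∧ ∀ n, iter R K θ h p b n d ≤ M + 1 := by
  set W := flux R K h b (fun _ => M + 1) (a + 1)
  obtain ⟨C, hC⟩ := (isCompact_Icc (a := a) (b := a + 1)).bddAbove_image
    (f := fun s => p (W / h s))
    (H.p_cont.comp (continuous_const.div H.h_cont fun t => (H.h_pos t).ne')).continuousOn
  have hC' : ∀ s ∈ Icc a (a + 1), p (W / h s) ≤ |C| + 1 := fun s hs =>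
    (hC (mem_image_of_mem _ hs)).trans (by linarith [le_abs_self C])
  have hC0 : 0 < |C| + 1 := by positivity
  have hδ : 0 < 1 / (|C| + 1) := by positivity
  have hδ1 : 1 / (|C| + 1) ≤ 1 := by
    rw [div_le_one hC0]
    linarith [abs_nonneg C]
  have had : a ≤ a + 1 / (|C| + 1) := by linarith
  refine ⟨a + 1 / (|C| + 1), by linarith, fun n => ?_⟩
  induction n with
  | zero => exact (hM 0).trans (by linarith)
  | succ n ih =>
    have h1 : ∫ x in a..a + 1 / (|C| + 1), speed R K h p b (iter R K θ h p b n) x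
        ≤ ∫ _ in a..a + 1 / (|C| + 1), (|C| + 1) := by
      refine intervalIntegral.integral_mono_on had
        ((continuous_speed H (continuous_iter H n)).intervalIntegrable _ _)
        (continuous_const.intervalIntegrable _ _) fun x hx => ?_
      refine (speed_le H (continuous_iter H n) (continuous_const (y := M + 1)) (ha.trans hx.1)
        (show x ≤ a + 1 by linarith [hx.2]) fun y hy => ?_).trans
        (hC' x ⟨hx.1, by linarith [hx.2]⟩)
      exact (monotoneOn_iter H hK n hy.1 (ha.trans had) (hy.2.trans hx.2)).trans ih
    rw [← iter_sub H, intervalIntegral.integral_const, smul_eq_mul, add_sub_cancel_left,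
      one_div_mul_cancel hC0.ne'] at h1
    linarith [hM (n + 1)]

/-- The pointwise supremum of the Picard iterates. -/
noncomputable def sol (R K θ : ℝ) (h p b : ℝ → ℝ) (t : ℝ) : ℝ :=
  ⨆ n, iter R K θ h p b n t

/-- The points at which the Picard iterates stay bounded. -/
def domain (R K θ : ℝ) (h p b : ℝ → ℝ) : Set ℝ :=
  {t | R ≤ t ∧ BddAbove (range fun n => iter R K θ h p b n t)}

theorem mem_domain_of_le (H : Admissible h p b) (hK : 0 < K) {s t : ℝ}
    (ht : t ∈ domain R K θ h p b) (hs : R ≤ s) (hst : s ≤ t) : s ∈ domain R K θ h p b := by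
  obtain ⟨M, hM⟩ := ht.2
  refine ⟨hs, M, ?_⟩
  rintro _ ⟨n, rfl⟩
  exact (monotoneOn_iter H hK n hs ht.1 hst).trans (hM ⟨n, rfl⟩)

theorem exists_gt_mem_domain (H : Admissible h p b) (hK : 0 < K) {t : ℝ}
    (ht : t ∈ domain R K θ h p b) : ∃ d ∈ domain R K θ h p b, t < d := by
  obtain ⟨M, hM⟩ := ht.2
  obtain ⟨d, hd, hb⟩ := exists_gt_iter_le H hK ht.1 fun n => hM ⟨n, rfl⟩
  refine ⟨d, ⟨ht.1.trans hd.le, M + 1, ?_⟩, hd⟩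
  rintro _ ⟨n, rfl⟩
  exact hb n

theorem left_mem_domain : R ∈ domain R K θ h p b := by
  refine ⟨le_rfl, θ, ?_⟩
  rintro _ ⟨n, rfl⟩
  cases n <;> simp [iter]

theorem iter_le_sol {t : ℝ} (ht : t ∈ domain R K θ h p b) (n : ℕ) :
    iter R K θ h p b n t ≤ sol R K θ h p b t :=
  le_ciSup ht.2 n

theorem monotoneOn_sol (H : Admissible h p b) (hK : 0 < K) :
    MonotoneOn (sol R K θ h p b) (domain R K θ h p b) := fun _ hs _ ht hst =>
  ciSup_le fun n => (monotoneOn_iter H hK n hs.1 ht.1 hst).trans (iter_le_sol ht n)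

theorem tendsto_iter (H : Admissible h p b) (hK : 0 < K) {t : ℝ}
    (ht : t ∈ domain R K θ h p b) :
    Tendsto (fun n => iter R K θ h p b n t) atTop (𝓝 (sol R K θ h p b t)) :=
  tendsto_atTop_ciSup (monotone_nat_of_le_succ fun n => iter_le_succ H hK n ht.1) ht.2

theorem tendsto_flux (H : Admissible h p b) (hK : 0 < K) {t : ℝ}
    (ht : t ∈ domain R K θ h p b) :
    Tendsto (fun n => flux R K h b (iter R K θ h p b n) t) atTop
      (𝓝 (flux R K h b (sol R K θ h p b) t)) := by
  refine tendsto_const_nhds.add (intervalIntegral.tendsto_integral_filter_of_dominated_convergence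
    (fun s => h s * b (sol R K θ h p b t)) (Eventually.of_forall fun n =>
      (H.h_cont.mul (H.b_cont.comp (continuous_iter H n))).aestronglyMeasurable)
    (Eventually.of_forall fun n => Eventually.of_forall fun s hs => ?_)
    ((H.h_cont.mul continuous_const).intervalIntegrable _ _)
    (Eventually.of_forall fun s hs => ?_))
  · rw [uIoc_of_le ht.1] at hs
    rw [Real.norm_of_nonneg (mul_nonneg (H.h_pos s).le (H.b_nonneg _))]
    exact mul_le_mul_of_nonneg_left (H.b_mono ((monotoneOn_iter H hK n hs.1.le ht.1 hs.2).trans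
      (iter_le_sol ht n))) (H.h_pos s).le
  · rw [uIoc_of_le ht.1] at hs
    exact tendsto_const_nhds.mul ((H.b_cont.tendsto _).comp
      (tendsto_iter H hK (mem_domain_of_le H hK ht hs.1.le hs.2)))

theorem sol_eq (H : Admissible h p b) (hK : 0 < K) {t : ℝ}
    (ht : t ∈ domain R K θ h p b) :
    sol R K θ h p b t = θ + ∫ s in R..t, speed R K h p b (sol R K θ h p b) s := by
  refine tendsto_nhds_unique ((tendsto_add_atTop_iff_nat 1).2 (tendsto_iter H hK ht)) ?_
  refine tendsto_const_nhds.add (intervalIntegral.tendsto_integral_filter_of_dominated_convergence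
    (fun s => p (flux R K h b (fun _ => sol R K θ h p b t) t / h s))
    (Eventually.of_forall fun n => (continuous_speed H (continuous_iter H n)).aestronglyMeasurable)
    (Eventually.of_forall fun n => Eventually.of_forall fun s hs => ?_)
    ((H.p_cont.comp (continuous_const.div H.h_cont
      fun t => (H.h_pos t).ne')).intervalIntegrable _ _)
    (Eventually.of_forall fun s hs => ?_))
  · rw [uIoc_of_le ht.1] at hs
    rw [Real.norm_of_nonneg (speed_pos H hK _ hs.1.le).le]
    exact speed_le H (continuous_iter H n) continuous_const hs.1.le hs.2 fun x hx =>
      (monotoneOn_iter H hK n hx.1 ht.1 (hx.2.trans hs.2)).trans (iter_le_sol ht n)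
  · rw [uIoc_of_le ht.1] at hs
    exact (H.p_cont.tendsto _).comp
      ((tendsto_flux H hK (mem_domain_of_le H hK ht hs.1.le hs.2)).div_const _)

theorem continuousOn_speed_sol (H : Admissible h p b) (hK : 0 < K) {t : ℝ}
    (ht : t ∈ domain R K θ h p b) :
    ContinuousOn (speed R K h p b (sol R K θ h p b)) (Icc R t) := by
  have hmono : MonotoneOn (fun s => b (sol R K θ h p b s)) (uIcc R t) := by
    rw [uIcc_of_le ht.1]
    exact fun x hx y hy hxy => H.b_mono (monotoneOn_sol H hK
      (mem_domain_of_le H hK ht hx.1 hx.2) (mem_domain_of_le H hK ht hy.1 hy.2) hxy)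
  have hint : IntervalIntegrable (fun s => h s * b (sol R K θ h p b s)) volume R t :=
    hmono.intervalIntegrable.continuousOn_mul H.h_cont.continuousOn
  have hprim := intervalIntegral.continuousOn_primitive_interval' hint left_mem_uIcc
  rw [uIcc_of_le ht.1] at hprim
  exact H.p_cont.comp_continuousOn ((continuousOn_const.add hprim).div H.h_cont.continuousOn
    fun s _ => (H.h_pos s).ne')

theorem hasDerivWithinAt_sol (H : Admissible h p b) (hK : 0 < K) {s t : ℝ}
    (ht : t ∈ domain R K θ h p b) (hs : s ∈ Icc R t) :
    HasDerivWithinAt (sol R K θ h p b) (speed R K h p b (sol R K θ h p b) s) (Icc R t) s := by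
  have hc := continuousOn_speed_sol H hK ht
  have : Fact (s ∈ Icc R t) := ⟨hs⟩
  have hd : HasDerivWithinAt
      (fun x => θ + ∫ y in R..x, speed R K h p b (sol R K θ h p b) y)
      (speed R K h p b (sol R K θ h p b) s) (Icc R t) s := by
    refine (intervalIntegral.integral_hasDerivWithinAt_right ?_ ?_ (hc s hs)).const_add θ
    · refine ContinuousOn.intervalIntegrable (hc.mono ?_)
      rw [uIcc_of_le hs.1]
      exact Icc_subset_Icc_right hs.2
    · exact hc.stronglyMeasurableAtFilter_nhdsWithin measurableSet_Icc s
  exact hd.congr_of_mem (fun x hx => sol_eq H hK (mem_domain_of_le H hK ht hx.1 hx.2)) hs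

theorem Icc_mem_nhdsWithin_domain {s t : ℝ} (hst : s < t) :
    Icc R t ∈ 𝓝[domain R K θ h p b] s :=
  mem_of_superset (inter_mem_nhdsWithin _ (Iio_mem_nhds hst)) fun _ hx => ⟨hx.1.1, hx.2.le⟩

theorem continuousOn_speed_domain (H : Admissible h p b) (hK : 0 < K) :
    ContinuousOn (speed R K h p b (sol R K θ h p b)) (domain R K θ h p b) := by
  intro s hs
  obtain ⟨t, ht, hst⟩ := exists_gt_mem_domain H hK hs
  exact (continuousOn_speed_sol H hK ht s ⟨hs.1, hst.le⟩).mono_of_mem_nhdsWithin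
    (Icc_mem_nhdsWithin_domain hst)

theorem hasDerivWithinAt_domain (H : Admissible h p b) (hK : 0 < K) {s : ℝ}
    (hs : s ∈ domain R K θ h p b) :
    HasDerivWithinAt (sol R K θ h p b) (speed R K h p b (sol R K θ h p b) s)
      (domain R K θ h p b) s := by
  obtain ⟨t, ht, hst⟩ := exists_gt_mem_domain H hK hs
  exact (hasDerivWithinAt_sol H hK ht ⟨hs.1, hst.le⟩).mono_of_mem_nhdsWithin
    (Icc_mem_nhdsWithin_domain hst)

theorem strictMonoOn_sol (H : Admissible h p b) (hK : 0 < K) :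
    StrictMonoOn (sol R K θ h p b) (domain R K θ h p b) := by
  have hconn : (domain R K θ h p b).OrdConnected :=
    ⟨fun x hx y hy _ hw => mem_domain_of_le H hK hy (hx.1.trans hw.1) hw.2⟩
  refine strictMonoOn_of_hasDerivWithinAt_pos hconn.convex
    (fun s hs => (hasDerivWithinAt_domain H hK hs).continuousWithinAt)
    (fun s hs => (hasDerivWithinAt_domain H hK (interior_subset hs)).mono interior_subset)
    fun s hs => speed_pos H hK _ (interior_subset hs).1

theorem domain_eq_Ici (H : Admissible h p b) (hK : 0 < K)
    (hd : ¬ BddAbove (domain R K θ h p b)) : domain R K θ h p b = Ici R := by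
  refine Subset.antisymm (fun t ht => ht.1) fun t ht => ?_
  obtain ⟨s, hs, hts⟩ := not_bddAbove_iff.1 hd t
  exact mem_domain_of_le H hK hs ht hts.le

theorem domain_eq_Ico (H : Admissible h p b) (hK : 0 < K)
    (hd : BddAbove (domain R K θ h p b)) :
    domain R K θ h p b = Ico R (sSup (domain R K θ h p b)) := by
  refine Subset.antisymm (fun t ht => ?_) fun t ht => ?_
  · obtain ⟨s, hs, hts⟩ := exists_gt_mem_domain H hK ht
    exact ⟨ht.1, hts.trans_le (le_csSup hd hs)⟩
  · obtain ⟨s, hs, hts⟩ := exists_lt_of_lt_csSup ⟨R, left_mem_domain⟩ ht.2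
    exact mem_domain_of_le H hK hs ht.1 hts.le

/-- Blow-up at a finite right endpoint of the domain. -/
theorem tendsto_sol_atTop (H : Admissible h p b) (hK : 0 < K) {ρ : ℝ} (hρ : R < ρ)
    (hd : domain R K θ h p b = Ico R ρ) :
    Tendsto (sol R K θ h p b) (𝓝[<] ρ) atTop := by
  refine tendsto_atTop.2 fun M => ?_
  obtain ⟨t, ht, hMt⟩ : ∃ t ∈ Ico R ρ, M < sol R K θ h p b t := by
    by_contra! hcon
    have hmem : ρ ∈ domain R K θ h p b := by
      refine ⟨hρ.le, M, ?_⟩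
      rintro _ ⟨n, rfl⟩
      refine le_of_tendsto (f := iter R K θ h p b n) (x := 𝓝[<] ρ)
        ((continuous_iter H n).continuousWithinAt) ?_
      filter_upwards [Ioo_mem_nhdsLT hρ] with t ht
      have htI : t ∈ Ico R ρ := ⟨ht.1.le, ht.2⟩
      exact (iter_le_sol (hd ▸ htI) n).trans (hcon t htI)
    rw [hd] at hmem
    exact lt_irrefl _ hmem.2
  filter_upwards [Ioo_mem_nhdsLT ht.2] with s hs
  have hsI : s ∈ Ico R ρ := ⟨ht.1.trans hs.1.le, hs.2⟩
  exact hMt.le.trans (monotoneOn_sol H hK (hd ▸ ht) (hd ▸ hsI) hs.1.le)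

end

/-- An increasing bijection of `[0, ∞)` has a continuous increasing inverse, extended to `ℝ`. -/
theorem exists_inverse {φ : ℝ → ℝ} (hφmono : StrictMonoOn φ (Ici (0 : ℝ))) (hφ0 : φ 0 = 0)
    (hφsurj : ∀ s : ℝ, 0 ≤ s → ∃ t : ℝ, 0 ≤ t ∧ φ t = s) :
    ∃ ψ : ℝ → ℝ, Continuous ψ ∧ Monotone ψ ∧ (∀ x, 0 < x → 0 < ψ x) ∧
      (∀ x, 0 ≤ x → φ (ψ x) = x) ∧ ∀ t, 0 ≤ t → ψ (φ t) = t := by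
  have hnn : ∀ t, 0 ≤ t → 0 ≤ φ t := fun t ht =>
    hφ0 ▸ hφmono.monotoneOn self_mem_Ici ht ht
  set F : ℝ → ℝ := fun t => if 0 ≤ t then φ t else t with hF
  have hpos : ∀ t, 0 ≤ t → F t = φ t := fun t ht => if_pos ht
  have hneg : ∀ t, t < 0 → F t = t := fun t ht => if_neg ht.not_ge
  have hmono : StrictMono F := by
    intro s t hst
    rcases le_or_gt 0 s with hs | hs
    · rw [hpos s hs, hpos t (hs.trans hst.le)]
      exact hφmono hs (hs.trans hst.le) hst
    · rw [hneg s hs]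
      rcases le_or_gt 0 t with ht | ht
      · rw [hpos t ht]
        exact hs.trans_le (hnn t ht)
      · rwa [hneg t ht]
  have hsurj : Function.Surjective F := by
    intro x
    rcases le_or_gt 0 x with hx | hx
    · obtain ⟨t, ht, rfl⟩ := hφsurj x hx
      exact ⟨t, hpos t ht⟩
    · exact ⟨x, hneg x hx⟩
  let e := hmono.orderIsoOfSurjective F hsurj
  have he : ∀ t, e t = F t := fun _ => rfl
  have he0 : e 0 = 0 := by rw [he, hpos 0 le_rfl, hφ0]
  have hes0 : e.symm 0 = 0 := by rw [e.symm_apply_eq, he0]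
  have hsymm : ∀ x, 0 ≤ x → 0 ≤ e.symm x := fun x hx => hes0 ▸ e.symm.monotone hx
  refine ⟨e.symm, e.symm.continuous, e.symm.monotone, fun x hx => ?_, fun x hx => ?_,
    fun t ht => ?_⟩
  · exact hes0 ▸ e.symm.strictMono hx
  · rw [← hpos _ (hsymm x hx), ← he, e.apply_symm_apply]
  · rw [← hpos t ht, ← he, e.symm_apply_apply]

end MonotoneCauchy

open MonotoneCauchy

/-- Local existence and maximal continuation for the Cauchy problem (6.5):
for every `θ ≥ 0`, `c ∈ (0,1]` and `μ > 0` there is a positive, increasing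
`C¹` solution on a maximal interval `[R,ρ)`, and if `ρ < +∞` then
`z(ρ⁻) = +∞`. -/
theorem cauchy_maximal_solution
    (R : ℝ) (hR : 0 < R) (m : ℕ) (hm : 2 ≤ m)
    (g : ℝ → ℝ) (hgcont : ContinuousOn g (Set.Ici R))
    (hgpos : ∀ t ∈ Set.Ici R, 0 < g t)
    (φ : ℝ → ℝ) (hφcont : ContinuousOn φ (Set.Ici (0 : ℝ)))
    (hφmono : StrictMonoOn φ (Set.Ici (0 : ℝ))) (hφ0 : φ 0 = 0)
    (hφsurj : ∀ s : ℝ, 0 ≤ s → ∃ t : ℝ, 0 ≤ t ∧ φ t = s)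
    (B : ℝ → ℝ) (hBcont : Continuous B) (hBnonneg : ∀ t : ℝ, 0 ≤ B t)
    (hBmono : Monotone B) (hBzero : ∀ t : ℝ, t ≤ 0 → B t = 0) :
    ∀ θ : ℝ, 0 ≤ θ → ∀ c : ℝ, 0 < c → c ≤ 1 → ∀ μ : ℝ, 0 < μ →
      (∃ z z' : ℝ → ℝ,
        IsCauchySolution R m c μ θ g φ B (Set.Ici R) z z') ∨
      (∃ ρ : ℝ, R < ρ ∧ ∃ z z' : ℝ → ℝ,
        IsCauchySolution R m c μ θ g φ B (Set.Ico R ρ) z z' ∧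
        Filter.Tendsto z (nhdsWithin ρ (Set.Iio ρ)) Filter.atTop) := by
  intro θ _ c hc _ μ hμ
  obtain ⟨ψ, hψc, hψm, hψp, hφψ, hψφ⟩ := exists_inverse hφmono hφ0 hφsurj
  set h : ℝ → ℝ := fun t => g (max R t) ^ (m - 1) with hh
  set p : ℝ → ℝ := fun x => c⁻¹ * ψ x with hp
  set b : ℝ → ℝ := fun x => B (c * x) with hb
  set K : ℝ := g R ^ (m - 1) * φ (c * μ) with hKdef
  have hcμ : 0 < c * μ := mul_pos hc hμ
  have hφcμ : 0 < φ (c * μ) := hφ0 ▸ hφmono self_mem_Ici hcμ.le hcμ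
  have hK : 0 < K := mul_pos (pow_pos (hgpos R self_mem_Ici) _) hφcμ
  have hhg : ∀ t, R ≤ t → h t = g t ^ (m - 1) := fun t ht => by simp only [hh, max_eq_right ht]
  have H : Admissible h p b :=
    { h_cont := (hgcont.comp_continuous (continuous_const.max continuous_id)
        fun t => le_max_left R t).pow _
      h_pos := fun t => pow_pos (hgpos _ (le_max_left R t)) _
      p_cont := continuous_const.mul hψc
      p_mono := hψm.const_mul (inv_pos.2 hc).le
      p_pos := fun x hx => mul_pos (inv_pos.2 hc) (hψp x hx)
      b_cont := hBcont.comp (continuous_const.mul continuous_id)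
      b_nonneg := fun x => hBnonneg _
      b_mono := fun x y hxy => hBmono (mul_le_mul_of_nonneg_left hxy hc.le) }
  have hsol : IsCauchySolution R m c μ θ g φ B (domain R K θ h p b)
      (sol R K θ h p b) (speed R K h p b (sol R K θ h p b)) := by
    refine ⟨?_, ?_, continuousOn_speed_domain H hK, fun t ht => speed_pos H hK _ ht.1,
      fun t ht => hasDerivWithinAt_domain H hK ht, strictMonoOn_sol H hK, fun t ht => ?_⟩
    · rw [sol_eq H hK left_mem_domain, intervalIntegral.integral_same, add_zero]
    · have hKR : K / h R = φ (c * μ) := by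
        rw [hhg R le_rfl, hKdef]
        exact mul_div_cancel_left₀ _ (pow_pos (hgpos R self_mem_Ici) _).ne'
      simp only [speed, flux, intervalIntegral.integral_same, add_zero, hKR]
      simp only [hp, hψφ _ hcμ.le]
      exact inv_mul_cancel_left₀ hc.ne' μ
    · have hint : ∫ s in R..t, g s ^ (m - 1) * B (c * sol R K θ h p b s)
          = ∫ s in R..t, h s * b (sol R K θ h p b s) := by
        refine intervalIntegral.integral_congr fun s hs => ?_
        rw [uIcc_of_le ht.1] at hs
        simp only [hb, hhg s hs.1]
      have hflux : 0 < flux R K h b (sol R K θ h p b) t := hK.trans_le (le_flux H _ ht.1)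
      rw [hint, ← hhg t ht.1]
      change h t * φ (c * (c⁻¹ * ψ (flux R K h b (sol R K θ h p b) t / h t)))
        = flux R K h b (sol R K θ h p b) t
      rw [mul_inv_cancel_left₀ hc.ne', hφψ _ (div_pos hflux (H.h_pos t)).le,
        mul_div_cancel₀ _ (H.h_pos t).ne']
  by_cases hd : BddAbove (domain R K θ h p b)
  · right
    have hD := domain_eq_Ico H hK hd
    have hρ : R < sSup (domain R K θ h p b) := (hD.subset left_mem_domain).2
    exact ⟨_, hρ, _, _, hD ▸ hsol, tendsto_sol_atTop H hK hρ hD⟩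
  · left
    exact ⟨_, _, domain_eq_Ici H hK hd ▸ hsol⟩
end

section
/- Assume in addition that g is non-decreasing on [R,∞) and that φ satisfies the structural bounds for some p > 1, a₁ ≥ 0, a₂ > 0. Let z be a solution of the Cauchy problem on [R,ρ) with initial height θ = 0, for some ρ ∈ (R,+∞]. Then for every t ∈ [R,ρ): ∫_0^{c z(t)} ds / K_{cμ}^{-1}(β(s)) ≤ t − R. -/
open intervalIntegral Set Filter Topology

/-- If `H` is antitone and `H(ζ) ζ' ≤ 1`, where `ζ'` is the right derivative of `ζ`,
then the primitive of `H` along `ζ` grows at most linearly. -/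
theorem integral_antitone_comp_le_sub {H ζ ζ' : ℝ → ℝ} {R T : ℝ} (hH : Antitone H)
    (hRT : R ≤ T) (hζR : ζ R = 0)
    (hζc : ContinuousOn ζ (Icc R T))
    (hζ : ∀ x ∈ Ico R T, HasDerivWithinAt ζ (ζ' x) (Ici x) x)
    (hle : ∀ x ∈ Ico R T, H (ζ x) * ζ' x ≤ 1) :
    ∫ s in (0 : ℝ)..ζ T, H s ≤ T - R := by
  have hint : ∀ a b, IntervalIntegrable H MeasureTheory.volume a b :=
    fun a b => hH.intervalIntegrable
  refine image_le_of_liminf_slope_right_le_deriv_boundary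
    (f := fun t => ∫ s in (0 : ℝ)..ζ t, H s) (B := fun t => t - R) (B' := fun _ => 1)
    ((continuous_primitive hint 0).comp_continuousOn hζc) (by simp [hζR]) (by fun_prop)
    (fun x _ => ((hasDerivAt_id x).sub_const R).hasDerivWithinAt) ?_ (right_mem_Icc.2 hRT)
  intro x hx r hr
  have hslope : Tendsto (fun y => H (ζ x) * slope ζ x y) (𝓝[>] x) (𝓝 (H (ζ x) * ζ' x)) := by
    have := hasDerivWithinAt_iff_tendsto_slope.1 (hζ x hx)
    rw [Ici_sdiff_left] at this
    exact this.const_mul _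
  refine Eventually.frequently ?_
  filter_upwards [hslope.eventually_lt_const ((hle x hx).trans_lt hr), self_mem_nhdsWithin]
    with y hy hxy
  refine lt_of_le_of_lt ?_ hy
  have hxy' : 0 < y - x := sub_pos.2 hxy
  have key : ∫ s in (ζ x)..(ζ y), H s ≤ H (ζ x) * (ζ y - ζ x) := by
    rcases le_total (ζ x) (ζ y) with h | h
    · calc ∫ s in (ζ x)..(ζ y), H s ≤ ∫ s in (ζ x)..(ζ y), H (ζ x) :=
            integral_mono_on h (hint _ _) intervalIntegrable_const fun s hs => hH hs.1
        _ = H (ζ x) * (ζ y - ζ x) := by simp [mul_comm]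
    · have : ∫ s in (ζ y)..(ζ x), H (ζ x) ≤ ∫ s in (ζ y)..(ζ x), H s :=
        integral_mono_on h intervalIntegrable_const (hint _ _) fun s hs => hH hs.2
      rw [integral_symm]
      simp only [integral_const, smul_eq_mul] at this
      linarith
  rw [slope_def_field, slope_def_field, integral_interval_sub_left (hint _ _) (hint _ _),
    ← mul_div_assoc]
  gcongr

/-- Increments of a monotone `φ` weighted by the position are controlled by the increments
of `φ`. -/
theorem integral_mul_deriv_le_mul_sub {φ : ℝ → ℝ} (hφ : ContDiffOn ℝ 1 φ (Ioi 0))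
    (hφ' : ∀ t, 0 < t → 0 < deriv φ t) {a b : ℝ} (ha : 0 < a) (hab : a ≤ b) :
    ∫ u in a..b, u * deriv φ u ≤ b * (φ b - φ a) := by
  have hsub : uIcc a b ⊆ Ioi 0 := by
    rw [uIcc_of_le hab]; exact fun u hu => ha.trans_le hu.1
  have hd : ContinuousOn (deriv φ) (uIcc a b) :=
    (hφ.continuousOn_deriv_of_isOpen isOpen_Ioi le_rfl).mono hsub
  have hint := hd.intervalIntegrable (μ := MeasureTheory.volume)
  rw [← integral_eq_sub_of_hasDerivAt (f := φ) (f' := deriv φ) (fun u hu =>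
    (((hφ.differentiableOn one_ne_zero).differentiableAt
      (isOpen_Ioi.mem_nhds (hsub hu)))).hasDerivAt) hint, ← integral_const_mul]
  refine integral_mono_on hab (continuousOn_id.mul hd).intervalIntegrable
    (hint.const_mul b) fun u hu => ?_
  exact mul_le_mul_of_nonneg_right hu.2 (hφ' u (ha.trans_le hu.1)).le

theorem intervalIntegrable_mul_deriv {φ : ℝ → ℝ} (hφ : ContDiffOn ℝ 1 φ (Ioi 0))
    {a b : ℝ} (ha : 0 < a) (hb : 0 < b) :
    IntervalIntegrable (fun u => u * deriv φ u) MeasureTheory.volume a b := by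
  have hsub : uIcc a b ⊆ Ioi 0 := fun u hu => (lt_min ha hb).trans_le hu.1
  exact (continuousOn_id.mul
    ((hφ.continuousOn_deriv_of_isOpen isOpen_Ioi le_rfl).mono hsub)).intervalIntegrable

theorem continuousOn_integral_mul_deriv {φ : ℝ → ℝ} (hφ : ContDiffOn ℝ 1 φ (Ioi 0))
    {a : ℝ} (ha : 0 < a) :
    ContinuousOn (fun t => ∫ u in a..t, u * deriv φ u) (Ioi 0) := by
  have hc : ContinuousOn (fun u => u * deriv φ u) (Ioi 0) :=
    continuousOn_id.mul (hφ.continuousOn_deriv_of_isOpen isOpen_Ioi le_rfl)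
  intro t ht
  have ht' := isOpen_Ioi.mem_nhds ht
  exact (integral_hasDerivAt_right (intervalIntegrable_mul_deriv hφ ha ht)
    (hc.stronglyMeasurableAtFilter isOpen_Ioi t ht)
    (hc.continuousAt ht')).continuousAt.continuousWithinAt

theorem integral_mul_deriv_strictMonoOn {φ : ℝ → ℝ} (hφ : ContDiffOn ℝ 1 φ (Ioi 0))
    (hφ' : ∀ t, 0 < t → 0 < deriv φ t) {a : ℝ} (ha : 0 < a) :
    StrictMonoOn (fun t => ∫ u in a..t, u * deriv φ u) (Ioi 0) := by
  intro s hs t ht hst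
  have hpos : 0 < ∫ u in s..t, u * deriv φ u :=
    intervalIntegral_pos_of_pos_on (intervalIntegrable_mul_deriv hφ hs ht)
      (fun u hu => mul_pos (lt_trans hs hu.1) (hφ' u (lt_trans hs hu.1))) hst
  rw [← integral_interval_sub_left (intervalIntegrable_mul_deriv hφ ha ht)
    (intervalIntegrable_mul_deriv hφ ha hs)] at hpos
  exact sub_pos.1 hpos

/-- Energy inequality: if `φ(w y) - φ(w x) ≤ (y - x) b(ζ y)` for `x ≤ y` and `w = ζ'`, then `∫ u φ'(u) du` up to `w` is bounded by the primitive of `b` up to `ζ`. -/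
theorem integral_mul_deriv_le_integral_of_increment_le {φ b ζ w : ℝ → ℝ} {R T : ℝ}
    (hφ : ContDiffOn ℝ 1 φ (Ioi 0)) (hφ' : ∀ t, 0 < t → 0 < deriv φ t)
    (hb : Continuous b) (hb0 : ∀ t, 0 ≤ b t) (hζR : ζ R = 0)
    (hζc : ContinuousOn ζ (Icc R T))
    (hζ : ∀ x ∈ Ico R T, HasDerivWithinAt ζ (w x) (Ici x) x)
    (hw : ContinuousOn w (Icc R T)) (hwpos : ∀ x ∈ Icc R T, 0 < w x)
    (hinc : ∀ x ∈ Icc R T, ∀ y ∈ Icc R T, x ≤ y →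
      φ (w y) - φ (w x) ≤ (y - x) * b (ζ y)) :
    ∀ t ∈ Icc R T, ∫ u in (w R)..(w t), u * deriv φ u ≤ ∫ s in (0 : ℝ)..ζ t, b s := by
  intro t ht
  have hR : 0 < w R := hwpos R ⟨le_rfl, ht.1.trans ht.2⟩
  have hbint : ∀ x y, IntervalIntegrable b MeasureTheory.volume x y :=
    fun x y => hb.intervalIntegrable x y
  refine image_le_of_liminf_slope_right_le_deriv_boundary
    (f := fun t => ∫ u in (w R)..(w t), u * deriv φ u) (B := fun t => ∫ s in (0 : ℝ)..ζ t, b s)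
    (B' := fun t => b (ζ t) * w t)
    ((continuousOn_integral_mul_deriv hφ hR).comp hw hwpos) (by simp [hζR])
    ((continuous_primitive hbint 0).comp_continuousOn hζc)
    (fun x hx => (hb.integral_hasStrictDerivAt 0 (ζ x)).hasDerivAt.comp_hasDerivWithinAt x (hζ x hx))
    ?_ ht
  intro x hx r hr
  have hxI : x ∈ Icc R T := Ico_subset_Icc_self hx
  have hmem : Icc R T ∈ 𝓝[>] x :=
    mem_of_superset (Ioc_mem_nhdsGT hx.2) fun y hy => ⟨hx.1.trans hy.1.le, hy.2⟩
  have hlim : Tendsto (fun y => b (ζ y) * w y) (𝓝[>] x) (𝓝 (b (ζ x) * w x)) :=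
    (((hb.comp_continuousOn hζc).mul hw) x hxI).mono_left (nhdsWithin_le_of_mem hmem)
  refine Eventually.frequently ?_
  filter_upwards [hlim.eventually_lt_const hr, self_mem_nhdsWithin, hmem] with y hy hxy hyI
  refine lt_of_le_of_lt ?_ hy
  have hxy' : 0 < y - x := sub_pos.2 hxy
  have hwx := hwpos x hxI
  have hwy := hwpos y hyI
  rw [slope_def_field, div_le_iff₀ hxy']
  rcases le_total (w x) (w y) with h | h
  · rw [integral_interval_sub_left (intervalIntegrable_mul_deriv hφ hR hwy)
      (intervalIntegrable_mul_deriv hφ hR hwx)]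
    calc _ ≤ w y * (φ (w y) - φ (w x)) := integral_mul_deriv_le_mul_sub hφ hφ' hwx h
      _ ≤ w y * ((y - x) * b (ζ y)) :=
        mul_le_mul_of_nonneg_left (hinc x hxI y hyI (le_of_lt hxy)) hwy.le
      _ = _ := by ring
  · have h1 := (integral_mul_deriv_strictMonoOn hφ hφ' hR).monotoneOn hwy hwx h
    have h2 : 0 ≤ b (ζ y) * w y * (y - x) := by have := hb0 (ζ y); positivity
    exact (sub_nonpos.2 h1).trans h2

/-- If `G v` is the integral of `G f` up to a constant, with `G` positive and monotone, and `f`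
monotone, then the increments of `v` are controlled by `f`. -/
theorem sub_le_of_mul_eq_const_add_integral {G v f : ℝ → ℝ} {R T C : ℝ}
    (hG : ContinuousOn G (Icc R T)) (hGpos : ∀ x ∈ Icc R T, 0 < G x)
    (hGmono : MonotoneOn G (Icc R T)) (hv : ∀ x ∈ Icc R T, 0 ≤ v x)
    (hf : ContinuousOn f (Icc R T)) (hf0 : ∀ x ∈ Icc R T, 0 ≤ f x)
    (hfmono : MonotoneOn f (Icc R T))
    (h : ∀ t ∈ Icc R T, G t * v t = C + ∫ s in R..t, G s * f s) :
    ∀ x ∈ Icc R T, ∀ y ∈ Icc R T, x ≤ y → v y - v x ≤ (y - x) * f y := by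
  intro x hx y hy hxy
  have hint : ∀ a ∈ Icc R T, ∀ b ∈ Icc R T,
      IntervalIntegrable (fun s => G s * f s) MeasureTheory.volume a b := fun a ha b hb =>
    ((hG.mul hf).mono (uIcc_subset_Icc ha hb)).intervalIntegrable
  have hRI : R ∈ Icc R T := ⟨le_rfl, hx.1.trans hx.2⟩
  have hsub := integral_interval_sub_left (hint R hRI y hy) (hint R hRI x hx)
  have hle : ∫ s in x..y, G s * f s ≤ ∫ s in x..y, G y * f y := by
    refine integral_mono_on hxy (hint x hx y hy) intervalIntegrable_const fun s hs => ?_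
    have hsI : s ∈ Icc R T := ⟨hx.1.trans hs.1, hs.2.trans hy.2⟩
    exact mul_le_mul (hGmono hsI hy hs.2) (hfmono hsI hy hs.2) (hf0 s hsI) (hGpos y hy).le
  rw [integral_const, smul_eq_mul] at hle
  have h1 := h x hx
  have h2 := h y hy
  have h3 : G x * v x ≤ G y * v x := mul_le_mul_of_nonneg_right (hGmono hx hy hxy) (hv x hx)
  refine le_of_mul_le_mul_left ?_ (hGpos y hy)
  linarith [mul_left_comm (y - x) (G y) (f y), mul_sub (G y) (v y) (v x)]

/-- The a priori estimate in the proof of Lemma 6.3: if `g` is non-decreasing,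
`φ` satisfies the structural bounds and `z` solves the Cauchy problem with
initial height `θ = 0` on `[R,ρ)` (`ρ ∈ (R,+∞]`), then for every `t` in the
interval of definition `∫_0^{c z(t)} ds / K_{cμ}⁻¹(β(s)) ≤ t - R`. -/
theorem cauchy_apriori_estimate
    (R : ℝ) (hR : 0 < R) (m : ℕ) (hm : 2 ≤ m)
    (c : ℝ) (hc : 0 < c) (hc1 : c ≤ 1)
    (μ : ℝ) (hμ : 0 < μ)
    (g : ℝ → ℝ) (hgcont : ContinuousOn g (Set.Ici R))
    (hgpos : ∀ t ∈ Set.Ici R, 0 < g t)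
    (hgmono : MonotoneOn g (Set.Ici R))
    (φ : ℝ → ℝ) (hφcont : ContinuousOn φ (Set.Ici (0 : ℝ)))
    (hφmono : StrictMonoOn φ (Set.Ici (0 : ℝ))) (hφ0 : φ 0 = 0)
    (p a₁ a₂ : ℝ) (hp : 1 < p) (ha₁ : 0 ≤ a₁) (ha₂ : 0 < a₂)
    (hφC1 : ContDiffOn ℝ 1 φ (Set.Ioi (0 : ℝ)))
    (hbounds : ∀ t : ℝ, 0 < t →
      a₂⁻¹ * t ^ (p - 1) ≤ t * deriv φ t ∧ t * deriv φ t ≤ a₁ + a₂ * t ^ (p - 1))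
    (B : ℝ → ℝ) (hBcont : Continuous B) (hBnonneg : ∀ t : ℝ, 0 ≤ B t)
    (hBmono : Monotone B) (hBzero : ∀ t : ℝ, t ≤ 0 → B t = 0)
    -- `Kinv` is the inverse of the bijection `K_{cμ} : [cμ,∞) → [0,∞)`,
    -- `K_{cμ}(t) = ∫_{cμ}^t s φ'(s) ds`
    (Kinv : ℝ → ℝ)
    (hKinv_left : ∀ t : ℝ, c * μ ≤ t →
      Kinv (∫ s in (c * μ)..t, s * deriv φ s) = t)
    (hKinv_right : ∀ s : ℝ, 0 ≤ s →
      c * μ ≤ Kinv s ∧ (∫ u in (c * μ)..(Kinv s), u * deriv φ u) = s)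
    -- the solution on `[R,ρ)`, `ρ ∈ (R,+∞]`
    (ρ : EReal) (hρ : (R : EReal) < ρ)
    (z z' : ℝ → ℝ)
    (hzR : z R = 0) (hz'R : z' R = μ)
    (hz'pos : ∀ t : ℝ, R ≤ t → (t : EReal) < ρ → 0 < z' t)
    (hz'cont : ContinuousOn z' {t : ℝ | R ≤ t ∧ (t : EReal) < ρ})
    (hderiv : ∀ t : ℝ, R ≤ t → (t : EReal) < ρ →
      HasDerivWithinAt z (z' t) {s : ℝ | R ≤ s ∧ (s : EReal) < ρ} t)
    (hODE : ∀ t : ℝ, R ≤ t → (t : EReal) < ρ →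
      g t ^ (m - 1) * φ (c * z' t)
        = g R ^ (m - 1) * φ (c * μ) + ∫ s in R..t, g s ^ (m - 1) * B (c * z s)) :
    ∀ t : ℝ, R ≤ t → (t : EReal) < ρ →
      (∫ s in (0:ℝ)..(c * z t), 1 / Kinv (∫ u in (0:ℝ)..s, B u)) ≤ t - R := by
  intro T hRT hTρ
  have hS : Icc R T ⊆ {t : ℝ | R ≤ t ∧ (t : EReal) < ρ} := fun t ht =>
    ⟨ht.1, (EReal.coe_le_coe_iff.2 ht.2).trans_lt hTρ⟩
  have hcμ : 0 < c * μ := mul_pos hc hμ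
  have hφ' : ∀ t, 0 < t → 0 < deriv φ t := fun t ht =>
    pos_of_mul_pos_right ((by positivity : 0 < a₂⁻¹ * t ^ (p - 1)).trans_le (hbounds t ht).1) ht.le
  have hzc : ContinuousOn z (Icc R T) := fun t ht =>
    (hderiv t (hS ht).1 (hS ht).2).continuousWithinAt.mono hS
  have hζ : ∀ x ∈ Ico R T, HasDerivWithinAt (fun t => c * z t) (c * z' x) (Ici x) x := by
    intro x hx
    have hx' := hS (Ico_subset_Icc_self hx)
    refine ((hderiv x hx'.1 hx'.2).mono_of_mem_nhdsWithin ?_).const_mul c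
    exact mem_of_superset (Icc_mem_nhdsGE hx.2) fun y hy => hS ⟨hx.1.trans hy.1, hy.2⟩
  have hζc : ContinuousOn (fun t => c * z t) (Icc R T) := continuousOn_const.mul hzc
  have hw : ContinuousOn (fun t => c * z' t) (Icc R T) := continuousOn_const.mul (hz'cont.mono hS)
  have hwpos : ∀ x ∈ Icc R T, 0 < c * z' x := fun x hx =>
    mul_pos hc (hz'pos x (hS hx).1 (hS hx).2)
  have hzmono : MonotoneOn z (Icc R T) := by
    refine monotoneOn_of_hasDerivWithinAt_nonneg (convex_Icc R T) hzc (f' := z') ?_ ?_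
    · intro x hx
      have hx' := hS (interior_subset hx)
      exact (hderiv x hx'.1 hx'.2).mono (interior_subset.trans hS)
    · intro x hx
      have hx' := hS (interior_subset hx)
      exact (hz'pos x hx'.1 hx'.2).le
  have hinc : ∀ x ∈ Icc R T, ∀ y ∈ Icc R T, x ≤ y →
      φ (c * z' y) - φ (c * z' x) ≤ (y - x) * B (c * z y) := by
    have hsub : Icc R T ⊆ Ici R := fun x hx => hx.1
    refine sub_le_of_mul_eq_const_add_integral (G := fun t => g t ^ (m - 1))
      (v := fun t => φ (c * z' t)) (f := fun t => B (c * z t)) ((hgcont.mono hsub).pow _)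
      (fun x hx => pow_pos (hgpos x (hsub hx)) _) ?_ ?_ (hBcont.comp_continuousOn hζc)
      (fun x _ => hBnonneg _) ?_ (fun t ht => hODE t (hS ht).1 (hS ht).2)
    · exact fun x hx y hy hxy => pow_le_pow_left₀ (hgpos x (hsub hx)).le
        (hgmono (hsub hx) (hsub hy) hxy) _
    · intro x hx
      have := hφmono.monotoneOn self_mem_Ici (hwpos x hx).le (hwpos x hx).le
      rwa [hφ0] at this
    · exact fun x hx y hy hxy => hBmono (mul_le_mul_of_nonneg_left (hzmono hx hy hxy) hc.le)
  have henergy := integral_mul_deriv_le_integral_of_increment_le (φ := φ) (b := B)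
    (ζ := fun t => c * z t) (w := fun t => c * z' t) hφC1 hφ' hBcont hBnonneg (by simp [hzR])
    hζc hζ hw hwpos hinc
  simp only [hz'R] at henergy
  have hK := integral_mul_deriv_strictMonoOn hφC1 hφ' hcμ
  have hBint : ∀ x y, IntervalIntegrable B MeasureTheory.volume x y :=
    fun x y => hBcont.intervalIntegrable x y
  have hβmono : Monotone fun s => ∫ u in (0 : ℝ)..s, B u := by
    intro x y hxy
    have := integral_nonneg (μ := MeasureTheory.volume) hxy fun u _ => hBnonneg u
    rw [← integral_interval_sub_left (hBint 0 y) (hBint 0 x)] at this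
    exact sub_nonneg.1 this
  have hβ0 : ∀ s, 0 ≤ ∫ u in (0 : ℝ)..s, B u := by
    intro s
    rcases le_total 0 s with h | h
    · exact integral_nonneg h fun u _ => hBnonneg u
    · rw [integral_congr (g := fun _ => (0 : ℝ)) fun u hu => hBzero u
        (by rw [uIcc_of_ge h] at hu; exact hu.2)]
      simp
  have hKinvpos : ∀ s, 0 ≤ s → 0 < Kinv s := fun s hs => hcμ.trans_le (hKinv_right s hs).1
  have hKinvle : ∀ s, 0 ≤ s → ∀ t, 0 < t → (∫ u in (c * μ)..t, u * deriv φ u) ≤ s →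
      t ≤ Kinv s := by
    intro s hs t ht hle
    refine (hK.le_iff_le ht (hKinvpos s hs)).1 ?_
    simpa only [(hKinv_right s hs).2] using hle
  refine integral_antitone_comp_le_sub (H := fun s => 1 / Kinv (∫ u in (0 : ℝ)..s, B u))
    (ζ := fun t => c * z t) (ζ' := fun t => c * z' t) ?_
    hRT (by simp [hzR]) hζc hζ ?_
  · intro x y hxy
    refine one_div_le_one_div_of_le (hKinvpos _ (hβ0 x)) ?_
    exact hKinvle _ (hβ0 y) _ (hKinvpos _ (hβ0 x))
      ((hKinv_right _ (hβ0 x)).2.le.trans (hβmono hxy))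
  · intro x hx
    have hxI := Ico_subset_Icc_self hx
    rw [one_div_mul_eq_div, div_le_one (hKinvpos _ (hβ0 _))]
    exact hKinvle _ (hβ0 _) _ (hwpos x hxI) (henergy x hxI)
end

section
/- Assume in addition that g is non-decreasing on [R,∞), that φ satisfies the structural bounds for some p > 1, a₁ ≥ 0, a₂ > 0, and that the Keller–Osserman condition fails in the sense that ∫_0^{+∞} ds / K_{cμ}^{-1}(β(s)) = +∞. Then the Cauchy problem with initial height θ = 0 has a solution defined on all of [R, +∞): there exists a C¹ function z : [R,∞) → ℝ with z(R) = 0, z'(R) = μ, z'(t) > 0 for all t, satisfying g(t)^{m−1} φ(c z'(t)) = g(R)^{m−1} φ(c μ) + ∫_R^t g(s)^{m−1} B(c z(s)) ds for all t ≥ R. -/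
open intervalIntegral MeasureTheory

open Filter Topology Set

/-- A strictly increasing bijection of `[0,∞)` extends to an order isomorphism of `ℝ`. -/
lemma StrictMonoOn.exists_orderIso_extension {φ : ℝ → ℝ}
    (hφ : StrictMonoOn φ (Ici (0 : ℝ))) (hφ0 : φ 0 = 0)
    (hφsurj : ∀ s : ℝ, 0 ≤ s → ∃ t : ℝ, 0 ≤ t ∧ φ t = s) :
    ∃ e : ℝ ≃o ℝ, ∀ x, 0 ≤ x → e x = φ x := by
  have hnonneg : ∀ x, 0 ≤ x → 0 ≤ φ x := fun x hx ↦ by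
    simpa [hφ0] using hφ.monotoneOn (mem_Ici.2 le_rfl) (mem_Ici.2 hx) hx
  let f : ℝ → ℝ := fun x ↦ if 0 ≤ x then φ x else x
  have hf : StrictMono f := by
    intro x y hxy
    by_cases hx : 0 ≤ x
    · have hy : 0 ≤ y := hx.trans hxy.le
      simpa [f, hx, hy] using hφ hx hy hxy
    · by_cases hy : 0 ≤ y
      · simpa [f, hx, hy] using (not_le.1 hx).trans_le (hnonneg y hy)
      · simpa [f, hx, hy] using hxy
  have hsurj : Function.Surjective f := by
    intro s
    by_cases hs : 0 ≤ s
    · obtain ⟨t, ht, rfl⟩ := hφsurj s hs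
      exact ⟨t, by simp [f, ht]⟩
    · exact ⟨s, by simp [f, hs]⟩
  exact ⟨hf.orderIsoOfSurjective f hsurj, fun x hx ↦ by simp [f, hx]⟩

/-- The primitive of a positive continuous function which is unbounded in both directions has
a differentiable inverse. -/
lemma exists_hasDerivAt_inverse_primitive {f : ℝ → ℝ} (hf : Continuous f) (hpos : ∀ x, 0 < f x)
    (a : ℝ) (htop : Tendsto (fun x ↦ ∫ s in a..x, f s) atTop atTop)
    (hbot : Tendsto (fun x ↦ ∫ s in a..x, f s) atBot atBot) :
    ∃ J : ℝ → ℝ, (∀ s, HasDerivAt J (f (J s))⁻¹ s) ∧ (∀ x, J (∫ s in a..x, f s) = x) ∧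
      ∀ s, ∫ u in a..J s, f u = s := by
  have hderiv : ∀ x, HasDerivAt (fun x ↦ ∫ s in a..x, f s) (f x) x := fun x ↦
    hf.integral_hasStrictDerivAt a x |>.hasDerivAt
  have hcont : Continuous fun x ↦ ∫ s in a..x, f s :=
    continuous_iff_continuousAt.2 fun x ↦ (hderiv x).continuousAt
  have hmono : StrictMono fun x ↦ ∫ s in a..x, f s :=
    strictMono_of_deriv_pos fun x ↦ by rw [(hderiv x).deriv]; exact hpos x
  let e := hmono.orderIsoOfSurjective _ (hcont.surjective htop hbot)
  refine ⟨e.symm, fun s ↦ ?_, fun x ↦ e.symm_apply_apply x, fun s ↦ e.apply_symm_apply s⟩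
  exact (hderiv (e.symm s)).of_local_left_inverse e.symm.continuous.continuousAt
    (hpos _).ne' (Eventually.of_forall fun y ↦ e.apply_symm_apply y)

lemma exists_inverse_primitive_of_le {f : ℝ → ℝ} (hf : Continuous f) {δ : ℝ} (hδ : 0 < δ)
    (hle : ∀ x, δ ≤ f x) (a : ℝ) :
    ∃ J : ℝ → ℝ, (∀ s, HasDerivAt J (f (J s))⁻¹ s) ∧ (∀ x, J (∫ s in a..x, f s) = x) ∧
      ∀ s, ∫ u in a..J s, f u = s := by
  refine exists_hasDerivAt_inverse_primitive hf (fun x ↦ hδ.trans_le (hle x)) a ?_ ?_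
  · refine tendsto_atTop_mono' _ ?_
      ((tendsto_atTop_add_const_right atTop (-a) tendsto_id).const_mul_atTop hδ)
    filter_upwards [eventually_ge_atTop a] with x hx
    have := intervalIntegral.integral_mono_on (f := fun _ ↦ δ) (μ := volume) hx
      (continuous_const.intervalIntegrable _ _)
      (hf.intervalIntegrable a x) fun s _ ↦ hle s
    simp only [intervalIntegral.integral_const, smul_eq_mul] at this
    simp only [id]
    linarith
  · refine tendsto_atBot_mono' _ ?_
      ((tendsto_atBot_add_const_right atBot (-a) tendsto_id).const_mul_atBot hδ)
    filter_upwards [eventually_le_atBot a] with x hx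
    have := intervalIntegral.integral_mono_on (f := fun _ ↦ δ) (μ := volume) hx
      (continuous_const.intervalIntegrable _ _)
      (hf.intervalIntegrable x a) fun s _ ↦ hle s
    simp only [intervalIntegral.integral_const, smul_eq_mul] at this
    rw [intervalIntegral.integral_symm]
    simp only [id]
    linarith

/-- Dominated convergence on a compact interval between two continuous functions. -/
lemma tendsto_intervalIntegral_of_le_of_le {f : ℕ → ℝ → ℝ} {l w f₀ : ℝ → ℝ} {a b : ℝ}
    (hab : a ≤ b) (hf : ∀ n, Continuous (f n)) (hl : Continuous l) (hw : Continuous w)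
    (hlf : ∀ n, ∀ u, a ≤ u → l u ≤ f n u) (hfw : ∀ n, ∀ u, a ≤ u → f n u ≤ w u)
    (hlim : ∀ u, a ≤ u → Tendsto (fun n ↦ f n u) atTop (𝓝 (f₀ u))) :
    Tendsto (fun n ↦ ∫ u in a..b, f n u) atTop (𝓝 (∫ u in a..b, f₀ u)) := by
  refine intervalIntegral.tendsto_integral_filter_of_dominated_convergence
    (fun u ↦ |l u| + |w u|) (Eventually.of_forall fun n ↦ (hf n).aestronglyMeasurable)
    (Eventually.of_forall fun n ↦ Eventually.of_forall fun u hu ↦ ?_)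
    ((hl.abs.add hw.abs).intervalIntegrable _ _) (Eventually.of_forall fun u hu ↦ ?_)
  all_goals rw [uIoc_of_le hab] at hu
  · have h1 := hlf n u hu.1.le
    have h2 := hfw n u hu.1.le
    rw [Real.norm_eq_abs, abs_le]
    constructor
    · linarith [neg_abs_le (l u), abs_nonneg (w u)]
    · linarith [le_abs_self (w u), abs_nonneg (l u)]
  · exact hlim u hu.1.le

/-- Monotone iteration for `z' = h(t, ∫ k(u, z(u)) du)` between `0` and a supersolution `y`. -/
lemma exists_solution_of_supersolution {h k : ℝ → ℝ → ℝ} {R : ℝ} {y' : ℝ → ℝ}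
    (hh : Continuous (Function.uncurry h)) (hk : Continuous (Function.uncurry k))
    (hhmono : ∀ t, R ≤ t → Monotone (h t)) (hkmono : ∀ t, R ≤ t → Monotone (k t))
    (hsub : ∀ t, R ≤ t → 0 ≤ h t (∫ u in R..t, k u 0)) (hy' : Continuous y')
    (hy'0 : ∀ t, R ≤ t → 0 ≤ y' t)
    (hsuper : ∀ t, R ≤ t → h t (∫ u in R..t, k u (∫ s in R..u, y' s)) ≤ y' t) :
    ∃ z : ℝ → ℝ, Continuous z ∧
      ∀ t, R ≤ t → z t = ∫ s in R..t, h s (∫ u in R..s, k u (z u)) := by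
  let y : ℝ → ℝ := fun t ↦ ∫ s in R..t, y' s
  let V : (ℝ → ℝ) → ℝ → ℝ := fun z t ↦ h t (∫ u in R..t, k u (z u))
  let T : (ℝ → ℝ) → ℝ → ℝ := fun z t ↦ ∫ s in R..t, V z s
  have primitive_cont : ∀ f : ℝ → ℝ, Continuous f → Continuous fun t ↦ ∫ s in R..t, f s :=
    fun f hf ↦ intervalIntegral.continuous_primitive (fun a b ↦ hf.intervalIntegrable a b) R
  have hkc : ∀ z : ℝ → ℝ, Continuous z → Continuous fun u ↦ k u (z u) := fun z hz ↦
    hk.comp (continuous_id.prodMk hz)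
  have hkc_right : ∀ u, Continuous (k u) := fun u ↦ hk.comp (continuous_const.prodMk continuous_id)
  have hhc_right : ∀ u, Continuous (h u) := fun u ↦ hh.comp (continuous_const.prodMk continuous_id)
  have hVc : ∀ z : ℝ → ℝ, Continuous z → Continuous (V z) := fun z hz ↦
    hh.comp (continuous_id.prodMk (primitive_cont _ (hkc z hz)))
  have hTc : ∀ z : ℝ → ℝ, Continuous z → Continuous (T z) := fun z hz ↦
    primitive_cont _ (hVc z hz)
  have hyc : Continuous y := primitive_cont _ hy'
  have hIle : ∀ v w : ℝ → ℝ, Continuous v → Continuous w → (∀ t, R ≤ t → v t ≤ w t) →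
      ∀ t, R ≤ t → ∫ u in R..t, k u (v u) ≤ ∫ u in R..t, k u (w u) := fun v w hv hw hvw t ht ↦
    intervalIntegral.integral_mono_on ht ((hkc v hv).intervalIntegrable _ _)
      ((hkc w hw).intervalIntegrable _ _) fun u hu ↦ hkmono u hu.1 (hvw u hu.1)
  have hVle : ∀ v w : ℝ → ℝ, Continuous v → Continuous w → (∀ t, R ≤ t → v t ≤ w t) →
      ∀ t, R ≤ t → V v t ≤ V w t := fun v w hv hw hvw t ht ↦
    hhmono t ht (hIle v w hv hw hvw t ht)
  have hTle : ∀ v w : ℝ → ℝ, Continuous v → Continuous w → (∀ t, R ≤ t → v t ≤ w t) →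
      ∀ t, R ≤ t → T v t ≤ T w t := fun v w hv hw hvw t ht ↦
    intervalIntegral.integral_mono_on ht ((hVc v hv).intervalIntegrable _ _)
      ((hVc w hw).intervalIntegrable _ _) fun u hu ↦ hVle v w hv hw hvw u hu.1
  have hTy : ∀ t, R ≤ t → T y t ≤ y t := fun t ht ↦
    intervalIntegral.integral_mono_on ht ((hVc y hyc).intervalIntegrable _ _)
      (hy'.intervalIntegrable _ _) fun u hu ↦ hsuper u hu.1
  have hT0 : ∀ t, R ≤ t → 0 ≤ T (fun _ ↦ 0) t := fun t ht ↦
    intervalIntegral.integral_nonneg ht fun u hu ↦ hsub u hu.1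
  let x : ℕ → ℝ → ℝ := fun n ↦ T^[n] fun _ ↦ 0
  have hxs : ∀ n, x (n + 1) = T (x n) := fun n ↦ Function.iterate_succ_apply' T n _
  have hxc : ∀ n, Continuous (x n) := by
    intro n
    induction n with
    | zero => exact continuous_const
    | succ n ih => rw [hxs]; exact hTc _ ih
  have hx_step : ∀ n t, R ≤ t → x n t ≤ x (n + 1) t := by
    intro n
    induction n with
    | zero => exact hT0
    | succ n ih =>
      intro t ht
      rw [hxs (n + 1), hxs n]
      exact hTle _ _ (hxc n) (by rw [← hxs]; exact hxc _) (by rwa [hxs] at ih) t ht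
  have hx_nonneg : ∀ n t, R ≤ t → 0 ≤ x n t := by
    intro n
    induction n with
    | zero => exact fun t _ ↦ le_rfl
    | succ n ih => exact fun t ht ↦ (ih t ht).trans (hx_step n t ht)
  have hx_le : ∀ n t, R ≤ t → x n t ≤ y t := by
    intro n
    induction n with
    | zero =>
      exact fun t ht ↦ intervalIntegral.integral_nonneg ht fun u hu ↦ hy'0 u hu.1
    | succ n ih =>
      intro t ht
      rw [hxs]
      exact (hTle _ _ (hxc n) hyc ih t ht).trans (hTy t ht)
  have hV_nonneg : ∀ n t, R ≤ t → 0 ≤ V (x n) t := fun n t ht ↦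
    (hsub t ht).trans (hVle _ _ continuous_const (hxc n) (hx_nonneg n) t ht)
  have hV_le : ∀ n t, R ≤ t → V (x n) t ≤ y' t := fun n t ht ↦
    (hVle _ _ (hxc n) hyc (hx_le n) t ht).trans (hsuper t ht)
  have hincr : ∀ n s t, R ≤ s → R ≤ t → |x n t - x n s| ≤ |y t - y s| := by
    have key : ∀ n s t, R ≤ s → s ≤ t → |x n t - x n s| ≤ |y t - y s| := by
      intro n s t hs hst
      have hy_diff : y t - y s = ∫ u in s..t, y' u :=
        intervalIntegral.integral_interval_sub_left (hy'.intervalIntegrable _ _)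
          (hy'.intervalIntegrable _ _)
      cases n with
      | zero => simp [x]
      | succ n =>
        have hx_diff : x (n + 1) t - x (n + 1) s = ∫ u in s..t, V (x n) u := by
          rw [hxs]
          exact intervalIntegral.integral_interval_sub_left
            ((hVc _ (hxc n)).intervalIntegrable _ _) ((hVc _ (hxc n)).intervalIntegrable _ _)
        have h0 : 0 ≤ ∫ u in s..t, V (x n) u :=
          intervalIntegral.integral_nonneg hst fun u hu ↦ hV_nonneg n u (hs.trans hu.1)
        rw [hx_diff, hy_diff, abs_of_nonneg h0]
        exact (intervalIntegral.integral_mono_on hst ((hVc _ (hxc n)).intervalIntegrable _ _)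
          (hy'.intervalIntegrable _ _) fun u hu ↦ hV_le n u (hs.trans hu.1)).trans (le_abs_self _)
    intro n s t hs ht
    rcases le_total s t with hst | hts
    · exact key n s t hs hst
    · rw [abs_sub_comm, abs_sub_comm (y t)]
      exact key n t s ht hts
  let z : ℝ → ℝ := fun t ↦ ⨆ n, x n (max R t)
  have hlim' : ∀ t, Tendsto (fun n ↦ x n (max R t)) atTop (𝓝 (z t)) := fun t ↦
    tendsto_atTop_ciSup (monotone_nat_of_le_succ fun n ↦ hx_step n _ (le_max_left _ _))
      ⟨y (max R t), by rintro _ ⟨n, rfl⟩; exact hx_le n _ (le_max_left _ _)⟩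
  have hlim : ∀ t, R ≤ t → Tendsto (fun n ↦ x n t) atTop (𝓝 (z t)) := fun t ht ↦ by
    simpa [max_eq_right ht] using hlim' t
  have hz_incr : ∀ s t, |z t - z s| ≤ |y (max R t) - y (max R s)| := fun s t ↦
    le_of_tendsto ((hlim' t).sub (hlim' s)).abs
      (Eventually.of_forall fun n ↦ hincr n _ _ (le_max_left _ _) (le_max_left _ _))
  have hzc : Continuous z := by
    refine continuous_iff_continuousAt.2 fun s ↦ ?_
    rw [ContinuousAt, tendsto_iff_dist_tendsto_zero]
    refine squeeze_zero (fun _ ↦ dist_nonneg) (fun t ↦ hz_incr s t) ?_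
    have : Continuous fun t ↦ |y (max R t) - y (max R s)| := by fun_prop
    simpa using this.tendsto s
  refine ⟨z, hzc, fun t ht ↦ ?_⟩
  have hIlim : ∀ s, R ≤ s →
      Tendsto (fun n ↦ ∫ u in R..s, k u (x n u)) atTop (𝓝 (∫ u in R..s, k u (z u))) :=
    fun s hs ↦ tendsto_intervalIntegral_of_le_of_le hs (fun n ↦ hkc _ (hxc n))
      (hkc _ continuous_const) (hkc y hyc) (fun n u hu ↦ hkmono u hu (hx_nonneg n u hu))
      (fun n u hu ↦ hkmono u hu (hx_le n u hu))
      fun u hu ↦ ((hkc_right u).tendsto _).comp (hlim u hu)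
  have hVlim : ∀ s, R ≤ s → Tendsto (fun n ↦ V (x n) s) atTop (𝓝 (V z s)) := fun s hs ↦
    ((hhc_right s).tendsto _).comp (hIlim s hs)
  have hTlim : Tendsto (fun n ↦ x (n + 1) t) atTop (𝓝 (∫ s in R..t, V z s)) := by
    simp only [hxs]
    exact tendsto_intervalIntegral_of_le_of_le ht (fun n ↦ hVc _ (hxc n)) continuous_const hy'
      hV_nonneg hV_le hVlim
  exact tendsto_nhds_unique ((hlim t ht).comp (tendsto_add_atTop_nat 1)) hTlim

/-- When the Keller–Osserman condition fails, the autonomous problem `(φ(Y'))' = B(Y)` with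
`Y(R) = 0` and `Y'(R) = ν` has a global solution. -/
lemma exists_autonomous_solution_of_notKO {φ B Kinv : ℝ → ℝ} {ν δ : ℝ} (R : ℝ)
    (hν : 0 < ν) (hδ : 0 < δ) (hφC1 : ContDiffOn ℝ 1 φ (Ioi (0 : ℝ)))
    (hle : ∀ t, ν ≤ t → δ ≤ t * deriv φ t)
    (hBcont : Continuous B) (hBnonneg : ∀ t : ℝ, 0 ≤ B t) (hBzero : ∀ t : ℝ, t ≤ 0 → B t = 0)
    (hKinv_right : ∀ s : ℝ, 0 ≤ s → ν ≤ Kinv s ∧ (∫ u in ν..Kinv s, u * deriv φ u) = s)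
    (hnotKO : ¬ IntegrableOn (fun s : ℝ ↦ 1 / Kinv (∫ u in (0 : ℝ)..s, B u)) (Ioi (0 : ℝ))) :
    ∃ Y Y' : ℝ → ℝ, Continuous Y' ∧ (∀ t, 0 < Y' t) ∧ (∀ t, HasDerivAt Y (Y' t) t) ∧ Y R = 0 ∧
      ∀ t, φ (Y' t) = φ ν + ∫ s in R..t, B (Y s) := by
  have hφd : ∀ t, 0 < t → HasDerivAt φ (deriv φ t) t := fun t ht ↦
    ((hφC1.differentiableOn one_ne_zero).differentiableAt (Ioi_mem_nhds ht)).hasDerivAt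
  let D : ℝ → ℝ := fun s ↦ max s ν * deriv φ (max s ν)
  have hD : Continuous D := by
    have hmax : Continuous fun s : ℝ ↦ max s ν := by fun_prop
    exact hmax.mul ((hφC1.continuousOn_deriv_of_isOpen isOpen_Ioi le_rfl).comp_continuous hmax
      fun s ↦ hν.trans_le (le_max_right _ _))
  obtain ⟨J, hJ, hJleft, -⟩ := exists_inverse_primitive_of_le hD hδ
    (fun s ↦ hle _ (le_max_right s ν)) ν
  have hJK : ∀ s, 0 ≤ s → J s = Kinv s := by
    intro s hs
    obtain ⟨h1, h2⟩ := hKinv_right s hs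
    have h3 : ∫ u in ν..Kinv s, D u = s := by
      conv_rhs => rw [← h2]
      refine intervalIntegral.integral_congr fun u hu ↦ ?_
      rw [uIcc_of_le h1] at hu
      simp only [D, max_eq_left hu.1]
    conv_lhs => rw [← h3]
    exact hJleft _
  let β : ℝ → ℝ := fun s ↦ ∫ u in (0 : ℝ)..s, B u
  have hβd : ∀ s, HasDerivAt β (B s) s := fun s ↦ (hBcont.integral_hasStrictDerivAt 0 s).hasDerivAt
  have hβ_neg : ∀ s, s ≤ 0 → β s = 0 := by
    intro s hs
    have h0 : ∫ u in (0 : ℝ)..s, B u = ∫ _ in (0 : ℝ)..s, (0 : ℝ) :=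
      intervalIntegral.integral_congr fun u hu ↦ by
        rw [uIcc_of_ge hs] at hu
        exact hBzero u hu.2
    simpa using h0
  have hβ0 : ∀ s, 0 ≤ β s := by
    intro s
    rcases le_total s 0 with hs | hs
    · exact (hβ_neg s hs).ge
    · exact intervalIntegral.integral_nonneg hs fun u _ ↦ hBnonneg u
  let W : ℝ → ℝ := fun s ↦ J (β s)
  have hWν : ∀ s, ν ≤ W s := fun s ↦ by
    simp only [W, hJK _ (hβ0 s)]
    exact (hKinv_right _ (hβ0 s)).1
  have hWpos : ∀ s, 0 < W s := fun s ↦ hν.trans_le (hWν s)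
  have hWd : ∀ s, HasDerivAt W ((D (W s))⁻¹ * B s) s := fun s ↦ (hJ (β s)).comp s (hβd s)
  have hWc : Continuous W := continuous_iff_continuousAt.2 fun s ↦ (hWd s).continuousAt
  have hJ0 : J 0 = ν := by simpa using hJleft ν
  have hφW : ∀ s, HasDerivAt (fun s ↦ φ (W s)) (B s / W s) s := by
    intro s
    have hd : deriv φ (W s) ≠ 0 := by
      have := hδ.trans_le (hle _ (hWν s))
      intro h0
      simp [h0] at this
    refine ((hφd _ (hWpos s)).comp s (hWd s)).congr_deriv ?_
    simp only [D, max_eq_left (hWν s)]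
    have := (hWpos s).ne'
    field_simp
  have hWi : Continuous fun s ↦ (W s)⁻¹ := hWc.inv₀ fun s ↦ (hWpos s).ne'
  have htop : Tendsto (fun x ↦ ∫ s in (0 : ℝ)..x, (W s)⁻¹) atTop atTop := by
    have hmono : Monotone fun x ↦ ∫ s in (0 : ℝ)..x, (W s)⁻¹ :=
      monotone_of_deriv_nonneg
        (fun x ↦ (hWi.integral_hasStrictDerivAt 0 x).hasDerivAt.differentiableAt) fun x ↦ by
          rw [(hWi.integral_hasStrictDerivAt 0 x).hasDerivAt.deriv]
          exact (inv_pos.2 (hWpos x)).le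
    rcases tendsto_atTop_of_monotone hmono with h | ⟨l, hl⟩
    · exact h
    · refine absurd ?_ hnotKO
      have hint : IntegrableOn (fun s ↦ (W s)⁻¹) (Ioi 0) :=
        integrableOn_Ioi_of_intervalIntegral_norm_tendsto l 0 (b := id)
          (fun i ↦ hWi.integrableOn_Ioc) tendsto_id <| by
            simpa only [Real.norm_of_nonneg (inv_pos.2 (hWpos _)).le, id] using hl
      refine hint.congr_fun (fun s _ ↦ ?_) measurableSet_Ioi
      simp only [W, hJK _ (hβ0 s), one_div, β]
  have hbot : Tendsto (fun x ↦ ∫ s in (0 : ℝ)..x, (W s)⁻¹) atBot atBot := by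
    refine Tendsto.congr' ?_ (tendsto_id.atBot_mul_const (inv_pos.2 hν))
    filter_upwards [eventually_le_atBot 0] with x hx
    have : ∫ s in (0 : ℝ)..x, (W s)⁻¹ = ∫ s in (0 : ℝ)..x, ν⁻¹ := by
      refine intervalIntegral.integral_congr fun u hu ↦ ?_
      rw [uIcc_of_ge hx] at hu
      simp only [W, hβ_neg u hu.2, hJ0]
    simp [this]
  obtain ⟨X, hX, hXleft, -⟩ := exists_hasDerivAt_inverse_primitive hWi
    (fun s ↦ inv_pos.2 (hWpos s)) 0 htop hbot
  have hX0 : X 0 = 0 := by simpa using hXleft 0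
  have hYd : ∀ t, HasDerivAt (fun t ↦ X (t - R)) (W (X (t - R))) t := fun t ↦ by
    simpa using (hX (t - R)).comp_sub_const t R
  have hYc : Continuous fun t ↦ X (t - R) :=
    continuous_iff_continuousAt.2 fun t ↦ (hYd t).continuousAt
  refine ⟨fun t ↦ X (t - R), fun t ↦ W (X (t - R)), hWc.comp hYc, fun t ↦ hWpos _, hYd,
    by simpa using hX0, fun t ↦ ?_⟩
  have hφY : ∀ s, HasDerivAt (fun s ↦ φ (W (X (s - R)))) (B (X (s - R))) s := fun s ↦ by
    refine ((hφW _).comp s (hYd s)).congr_deriv ?_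
    exact div_mul_cancel₀ _ (hWpos _).ne'
  rw [intervalIntegral.integral_eq_sub_of_hasDerivAt (fun s _ ↦ hφY s)
    ((hBcont.comp hYc).intervalIntegrable _ _)]
  simp [W, hX0, hβ_neg 0 le_rfl, hJ0]

/-- Lemma 6.3 of the paper: if `g` is non-decreasing, `φ` satisfies the
structural bounds, and the Keller–Osserman condition fails
(`∫_0^∞ ds / K_{cμ}⁻¹(β(s)) = +∞`, expressed as non-integrability of the
nonnegative integrand on `(0,∞)`), then the Cauchy problem with initial
height `θ = 0` has a positive, increasing `C¹` solution defined on all of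
`[R,+∞)`. -/
theorem cauchy_global_solution_of_notKO
    (R : ℝ) (hR : 0 < R) (m : ℕ) (hm : 2 ≤ m)
    (c : ℝ) (hc : 0 < c) (hc1 : c ≤ 1)
    (μ : ℝ) (hμ : 0 < μ)
    (g : ℝ → ℝ) (hgcont : ContinuousOn g (Set.Ici R))
    (hgpos : ∀ t ∈ Set.Ici R, 0 < g t)
    (hgmono : MonotoneOn g (Set.Ici R))
    (φ : ℝ → ℝ) (hφcont : ContinuousOn φ (Set.Ici (0 : ℝ)))
    (hφmono : StrictMonoOn φ (Set.Ici (0 : ℝ))) (hφ0 : φ 0 = 0)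
    (hφsurj : ∀ s : ℝ, 0 ≤ s → ∃ t : ℝ, 0 ≤ t ∧ φ t = s)
    (p a₁ a₂ : ℝ) (hp : 1 < p) (ha₁ : 0 ≤ a₁) (ha₂ : 0 < a₂)
    (hφC1 : ContDiffOn ℝ 1 φ (Set.Ioi (0 : ℝ)))
    (hbounds : ∀ t : ℝ, 0 < t →
      a₂⁻¹ * t ^ (p - 1) ≤ t * deriv φ t ∧ t * deriv φ t ≤ a₁ + a₂ * t ^ (p - 1))
    (B : ℝ → ℝ) (hBcont : Continuous B) (hBnonneg : ∀ t : ℝ, 0 ≤ B t)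
    (hBmono : Monotone B) (hBzero : ∀ t : ℝ, t ≤ 0 → B t = 0)
    -- `Kinv` is the inverse of the bijection `K_{cμ} : [cμ,∞) → [0,∞)`,
    -- `K_{cμ}(t) = ∫_{cμ}^t s φ'(s) ds`
    (Kinv : ℝ → ℝ)
    (hKinv_left : ∀ t : ℝ, c * μ ≤ t →
      Kinv (∫ s in (c * μ)..t, s * deriv φ s) = t)
    (hKinv_right : ∀ s : ℝ, 0 ≤ s →
      c * μ ≤ Kinv s ∧ (∫ u in (c * μ)..(Kinv s), u * deriv φ u) = s)
    -- failure of the Keller–Osserman condition, `β(s) = ∫_0^s B(u) du`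
    (hnotKO : ¬ IntegrableOn
      (fun s : ℝ => 1 / Kinv (∫ u in (0:ℝ)..s, B u)) (Set.Ioi (0 : ℝ))) :
    ∃ z z' : ℝ → ℝ,
      z R = 0 ∧ z' R = μ ∧
      ContinuousOn z' (Set.Ici R) ∧
      (∀ t ∈ Set.Ici R, 0 < z' t) ∧
      (∀ t ∈ Set.Ici R, HasDerivWithinAt z (z' t) (Set.Ici R) t) ∧
      (∀ t ∈ Set.Ici R,
        g t ^ (m - 1) * φ (c * z' t)
          = g R ^ (m - 1) * φ (c * μ)
            + ∫ s in R..t, g s ^ (m - 1) * B (c * z s)) := by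
  have hν : 0 < c * μ := mul_pos hc hμ
  have hq : 0 < a₂⁻¹ * (c * μ) ^ (p - 1) := mul_pos (inv_pos.2 ha₂) (Real.rpow_pos_of_pos hν _)
  obtain ⟨Y, Y', hY'c, hY'pos, hYd, hYR, hYφ⟩ := exists_autonomous_solution_of_notKO R hν hq hφC1
    (fun t ht ↦ le_trans (mul_le_mul_of_nonneg_left
      (Real.rpow_le_rpow hν.le ht (by linarith)) (inv_pos.2 ha₂).le)
      (hbounds t (hν.trans_le ht)).1)
    hBcont hBnonneg hBzero hKinv_right hnotKO
  have hYint : ∀ t, ∫ s in R..t, Y' s / c = Y t / c := fun t ↦ by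
    rw [intervalIntegral.integral_div, intervalIntegral.integral_eq_sub_of_hasDerivAt
      (fun s _ ↦ hYd s) (hY'c.intervalIntegrable _ _), hYR, sub_zero]
  have hYc : Continuous Y := continuous_iff_continuousAt.2 fun t ↦ (hYd t).continuousAt
  obtain ⟨e, he⟩ := hφmono.exists_orderIso_extension hφ0 hφsurj
  have he0 : e.symm 0 = 0 := by rw [e.symm_apply_eq, he 0 le_rfl, hφ0]
  let G : ℝ → ℝ := fun t ↦ g (max R t) ^ (m - 1)
  have hGc : Continuous G := (hgcont.comp_continuous (by fun_prop) fun t ↦ le_max_left R t).pow _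
  have hGpos : ∀ t, 0 < G t := fun t ↦ pow_pos (hgpos _ (le_max_left R t)) _
  have hGmono : Monotone G := fun s t hst ↦
    pow_le_pow_left₀ (hgpos _ (le_max_left R s)).le
      (hgmono (le_max_left R s) (le_max_left R t) (max_le_max_left R hst)) _
  have hGg : ∀ t, R ≤ t → G t = g t ^ (m - 1) := fun t ht ↦ by simp only [G, max_eq_right ht]
  have hA : 0 < G R * φ (c * μ) :=
    mul_pos (hGpos R) (by simpa [hφ0] using hφmono (mem_Ici.2 le_rfl) (mem_Ici.2 hν.le) hν)
  let h : ℝ → ℝ → ℝ := fun t x ↦ e.symm ((G R * φ (c * μ) + x) / G t) / c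
  let k : ℝ → ℝ → ℝ := fun u x ↦ G u * B (c * x)
  have hh : Continuous (Function.uncurry h) := by
    have : Continuous fun q : ℝ × ℝ ↦ (G R * φ (c * μ) + q.2) / G q.1 :=
      (continuous_const.add continuous_snd).div (hGc.comp continuous_fst) fun q ↦ (hGpos _).ne'
    exact (e.symm.continuous.comp this).div_const c
  have hk : Continuous (Function.uncurry k) :=
    (hGc.comp continuous_fst).mul (hBcont.comp (continuous_const.mul continuous_snd))
  have hhpos : ∀ t x, 0 ≤ x → 0 < h t x := fun t x hx ↦ by
    refine div_pos ?_ hc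
    rw [← he0]
    exact e.symm.strictMono (div_pos (by linarith) (hGpos t))
  have hk_nonneg : ∀ (v : ℝ → ℝ) t, R ≤ t → 0 ≤ ∫ u in R..t, k u (v u) := fun v t ht ↦
    intervalIntegral.integral_nonneg ht fun u _ ↦ mul_nonneg (hGpos u).le (hBnonneg _)
  obtain ⟨z, hzc, hz⟩ := exists_solution_of_supersolution (R := R) (y' := fun t ↦ Y' t / c) hh hk
    (fun t _ x x' hx ↦ div_le_div_of_nonneg_right (e.symm.monotone
      (div_le_div_of_nonneg_right (by linarith) (hGpos t).le)) hc.le)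
    (fun t _ x x' hx ↦ mul_le_mul_of_nonneg_left
      (hBmono (mul_le_mul_of_nonneg_left hx hc.le)) (hGpos t).le)
    (fun t ht ↦ (hhpos t _ (hk_nonneg (fun _ ↦ 0) t ht)).le) (hY'c.div_const c)
    (fun t _ ↦ (div_pos (hY'pos t) hc).le) (fun t ht ↦ by
      refine div_le_div_of_nonneg_right ?_ hc.le
      rw [e.symm_apply_le, he _ (hY'pos t).le, div_le_iff₀ (hGpos t), hYφ t, add_mul]
      refine add_le_add ?_ ?_
      · rw [mul_comm]
        exact mul_le_mul_of_nonneg_left (hGmono ht) (pos_of_mul_pos_right hA (hGpos R).le).le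
      · rw [← intervalIntegral.integral_mul_const]
        simp only [k, hYint, mul_div_cancel₀ _ hc.ne']
        refine intervalIntegral.integral_mono_on ht
          ((hGc.mul (hBcont.comp hYc)).intervalIntegrable _ _)
          (((hBcont.comp hYc).mul continuous_const).intervalIntegrable _ _) fun u hu ↦ ?_
        rw [mul_comm]
        exact mul_le_mul_of_nonneg_left (hGmono hu.2) (hBnonneg _))
  let z' : ℝ → ℝ := fun t ↦ h t (∫ u in R..t, k u (z u))
  have hkz : Continuous fun u ↦ k u (z u) := hk.comp (continuous_id.prodMk hzc)
  have hz'c : Continuous z' := hh.comp (continuous_id.prodMk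
    (intervalIntegral.continuous_primitive (fun a b ↦ hkz.intervalIntegrable a b) R))
  have hz'pos : ∀ t, R ≤ t → 0 < z' t := fun t ht ↦ hhpos t _ (hk_nonneg z t ht)
  refine ⟨z, z', by simp [hz R le_rfl], ?_, hz'c.continuousOn, hz'pos, fun t ht ↦ ?_, fun t ht ↦ ?_⟩
  · have : e.symm (φ (c * μ)) = c * μ := by rw [e.symm_apply_eq, he _ hν.le]
    simp only [z', h, intervalIntegral.integral_same, add_zero,
      mul_div_cancel_left₀ _ (hGpos R).ne', this, mul_div_cancel_left₀ _ hc.ne']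
  · exact ((hz'c.integral_hasStrictDerivAt R t).hasDerivAt.hasDerivWithinAt).congr
      (fun s hs ↦ hz s hs) (hz t ht)
  · have hcz : φ (c * z' t) = (G R * φ (c * μ) + ∫ u in R..t, k u (z u)) / G t := by
      rw [← he _ (mul_pos hc (hz'pos t ht)).le]
      simp only [z', h, mul_div_cancel₀ _ hc.ne', e.apply_symm_apply]
    rw [hcz, ← hGg t ht, ← hGg R le_rfl, mul_div_cancel₀ _ (hGpos t).ne']
    congr 1
    refine intervalIntegral.integral_congr fun u hu ↦ ?_
    rw [uIcc_of_le ht] at hu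
    simp only [k, hGg u hu.1]
end

section
/- Assume g is non-decreasing on [R,∞), and let R̂ > R. Let w : [R,∞) → ℝ be C¹ with w(R) = 0, w'(t) > 0 for all t, satisfying g(r)^{m−1} φ(w'(r)) = g(R)^{m−1} φ(w'(R)) + ∫_R^r g(s)^{m−1} B(w(s)) ds for all r ≥ R. Let c ∈ (0,1], μ > 0, and let z : [R̂,∞) → ℝ be C¹ with z(R̂) = 0, z'(t) > 0 for all t, satisfying g(r)^{m−1} φ(c z'(r)) = g(R̂)^{m−1} φ(c μ) + ∫_{R̂}^r g(s)^{m−1} B(c z(s)) ds for all r ≥ R̂. If g(R)^{m−1} φ(w'(R)) > g(R̂)^{m−1} φ(c μ), then c z(r) < w(r) for every r ∈ [R̂, ∞). -/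
open intervalIntegral

/-- The comparison lemma of Section 6: if `w` solves the Cauchy problem on
`[R,∞)` with `w(R) = 0`, and `z` solves it on `[R̂,∞)` (`R̂ > R`) with
`z(R̂) = 0` and initial data so small that
`g(R)^(m-1) φ(w'(R)) > g(R̂)^(m-1) φ(cμ)`, then `c z < w` on `[R̂,∞)`. -/
theorem comparison_of_radial_solutions
    (R : ℝ) (hR : 0 < R) (m : ℕ) (hm : 2 ≤ m)
    (g : ℝ → ℝ) (hgcont : ContinuousOn g (Set.Ici R))
    (hgpos : ∀ t ∈ Set.Ici R, 0 < g t)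
    (hgmono : MonotoneOn g (Set.Ici R))
    (φ : ℝ → ℝ) (hφcont : ContinuousOn φ (Set.Ici (0 : ℝ)))
    (hφmono : StrictMonoOn φ (Set.Ici (0 : ℝ))) (hφ0 : φ 0 = 0)
    (B : ℝ → ℝ) (hBcont : Continuous B) (hBnonneg : ∀ t : ℝ, 0 ≤ B t)
    (hBmono : Monotone B) (hBzero : ∀ t : ℝ, t ≤ 0 → B t = 0)
    (Rhat : ℝ) (hRhat : R < Rhat)
    -- the solution `w` on `[R,∞)`
    (w w' : ℝ → ℝ)
    (hwR : w R = 0)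
    (hw'pos : ∀ t ∈ Set.Ici R, 0 < w' t)
    (hwderiv : ∀ t ∈ Set.Ici R, HasDerivWithinAt w (w' t) (Set.Ici R) t)
    (hwODE : ∀ r ∈ Set.Ici R,
      g r ^ (m - 1) * φ (w' r)
        = g R ^ (m - 1) * φ (w' R) + ∫ s in R..r, g s ^ (m - 1) * B (w s))
    -- the solution `z` on `[R̂,∞)`
    (c : ℝ) (hc : 0 < c) (hc1 : c ≤ 1)
    (μ : ℝ) (hμ : 0 < μ)
    (z z' : ℝ → ℝ)
    (hzR : z Rhat = 0)
    (hz'pos : ∀ t ∈ Set.Ici Rhat, 0 < z' t)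
    (hzderiv : ∀ t ∈ Set.Ici Rhat, HasDerivWithinAt z (z' t) (Set.Ici Rhat) t)
    (hzODE : ∀ r ∈ Set.Ici Rhat,
      g r ^ (m - 1) * φ (c * z' r)
        = g Rhat ^ (m - 1) * φ (c * μ)
          + ∫ s in Rhat..r, g s ^ (m - 1) * B (c * z s))
    -- smallness of the initial slope of `z`
    (hsmall : g Rhat ^ (m - 1) * φ (c * μ) < g R ^ (m - 1) * φ (w' R)) :
    ∀ r ∈ Set.Ici Rhat, c * z r < w r := by
  have hsub : Set.Ici Rhat ⊆ Set.Ici R := Set.Ici_subset_Ici.2 hRhat.le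
  have hwc : ContinuousOn w (Set.Ici R) := fun t ht => (hwderiv t ht).continuousWithinAt
  have hzc : ContinuousOn z (Set.Ici Rhat) := fun t ht => (hzderiv t ht).continuousWithinAt
  have hwRhat : 0 < w Rhat := by
    have hmono : StrictMonoOn w (Set.Ici R) :=
      strictMonoOn_of_hasDerivWithinAt_pos (convex_Ici R) hwc
        (fun x hx => (hwderiv x (interior_subset hx)).mono interior_subset)
        (fun x hx => hw'pos x (interior_subset hx))
    simpa [hwR] using hmono Set.self_mem_Ici hRhat.le hRhat
  have hczc : ContinuousOn (fun t => c * z t) (Set.Ici Rhat) := continuousOn_const.mul hzc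
  have hvc : ContinuousOn (fun t => w t - c * z t) (Set.Ici Rhat) := (hwc.mono hsub).sub hczc
  have hwint : ContinuousOn (fun s => g s ^ (m - 1) * B (w s)) (Set.Ici R) :=
    (hgcont.pow _).mul (hBcont.comp_continuousOn hwc)
  have hzint : ContinuousOn (fun s => g s ^ (m - 1) * B (c * z s)) (Set.Ici Rhat) :=
    ((hgcont.mono hsub).pow _).mul (hBcont.comp_continuousOn hczc)
  intro r hr
  by_contra! hcross
  -- the first point at which `c z` catches up with `w`
  obtain ⟨t₀, ⟨⟨ht₀, ht₀r⟩, hle⟩, hmin⟩ :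
      ∃ t₀, IsLeast (Set.Icc Rhat r ∩ (fun t => w t - c * z t) ⁻¹' Set.Iic 0) t₀ :=
    (isCompact_Icc.of_isClosed_subset
      ((hvc.mono Set.Icc_subset_Ici_self).preimage_isClosed_of_isClosed isClosed_Icc isClosed_Iic)
      Set.inter_subset_left).exists_isLeast
      ⟨r, ⟨hr, le_rfl⟩, sub_nonpos.2 hcross⟩
  have hbefore : ∀ s, Rhat ≤ s → s < t₀ → c * z s < w s := by
    intro s hs hst
    by_contra! h
    exact absurd (hmin ⟨⟨hs, hst.le.trans ht₀r⟩, sub_nonpos.2 h⟩) (not_le.2 hst)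
  have hslope : ∀ t, Rhat ≤ t → t < t₀ → c * z' t < w' t := by
    intro t ht htt
    have htR : R ≤ t := hRhat.le.trans ht
    have hiw₁ := (hwint.mono Set.Icc_subset_Ici_self).intervalIntegrable_of_Icc hRhat.le
      (μ := MeasureTheory.volume)
    have hiw₂ := (hwint.mono (Set.Icc_subset_Ici_self.trans hsub)).intervalIntegrable_of_Icc ht
      (μ := MeasureTheory.volume)
    have hiz := (hzint.mono Set.Icc_subset_Ici_self).intervalIntegrable_of_Icc ht
      (μ := MeasureTheory.volume)
    have hfirst : 0 ≤ ∫ s in R..Rhat, g s ^ (m - 1) * B (w s) :=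
      integral_nonneg hRhat.le fun s hs =>
        mul_nonneg (pow_nonneg (hgpos s hs.1).le _) (hBnonneg _)
    have hsecond : ∫ s in Rhat..t, g s ^ (m - 1) * B (c * z s)
        ≤ ∫ s in Rhat..t, g s ^ (m - 1) * B (w s) :=
      integral_mono_on ht hiz hiw₂ fun s hs =>
        mul_le_mul_of_nonneg_left (hBmono (hbefore s hs.1 (hs.2.trans_lt htt)).le)
          (pow_nonneg (hgpos s (hsub hs.1)).le _)
    have hflux : g t ^ (m - 1) * φ (c * z' t) < g t ^ (m - 1) * φ (w' t) := by
      rw [hwODE t htR, hzODE t ht, ← integral_add_adjacent_intervals hiw₁ hiw₂]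
      linarith
    exact (hφmono.lt_iff_lt (mul_pos hc (hz'pos t ht)).le (hw'pos t htR).le).1
      (lt_of_mul_lt_mul_left hflux (pow_nonneg (hgpos t htR).le _))
  have hmono : StrictMonoOn (fun t => w t - c * z t) (Set.Icc Rhat t₀) := by
    refine strictMonoOn_of_hasDerivWithinAt_pos (f' := fun t => w' t - c * z' t)
      (convex_Icc _ _) (hvc.mono Set.Icc_subset_Ici_self) (fun x hx => ?_) (fun x hx => ?_)
    · have hx' : x ∈ Set.Ici Rhat := (interior_subset hx).1
      have hi : interior (Set.Icc Rhat t₀) ⊆ Set.Ici Rhat :=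
        interior_subset.trans Set.Icc_subset_Ici_self
      exact ((hwderiv x (hsub hx')).mono (hi.trans hsub)).sub
        (((hzderiv x hx').mono hi).const_mul c)
    · rw [interior_Icc] at hx
      exact sub_pos.2 (hslope x hx.1.le hx.2)
  have hfinal := hmono.monotoneOn (Set.left_mem_Icc.2 ht₀) (Set.right_mem_Icc.2 ht₀) ht₀
  simp only [hzR, mul_zero, sub_zero] at hfinal
  exact absurd (hwRhat.trans_le hfinal) (not_lt.2 hle)
end
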